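/- arXiv:1901.00327 — 2 statements merged into one kernel-verified Lean document; each statement's English description precedes it below -/
import Mathlib

section
/- Let (X,A,T,μ) be an invertible measure-preserving system on a Lebesgue probability space and let P be an excellent measurable partition. Then ⋂_{k=1}^∞ T^{-k} σ(P^-) = Π_μ mod μ, i.e., the tail σ-algebra of P equals the Pinsker σ-algebra. -/
open MeasureTheory Filter Topology Set
open scoped symmDiff Classical ENNReal NNReal

section Defs

variable {X : Type*}

/-- The pair `(x, y)` is (positively) asymptotic for `T`. -/
def IsAsymptoticPair [PseudoMetricSpace X] (T : X → X) (x y : X) : Prop :=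
  Tendsto (fun n : ℕ => dist (T^[n] x) (T^[n] y)) atTop (𝓝 0)

/-- Shannon entropy of the finite measurable partition of `X` given by the fibers of a
map `p` into a finite type. -/
noncomputable def partEntropy [MeasurableSpace X] (μ : Measure X) {ι : Type*} [Fintype ι]
    (p : X → ι) : ℝ :=
  ∑ i : ι, Real.negMulLog (μ (p ⁻¹' {i})).toReal

/-- Conditional Shannon entropy `H(P | F)` of the finite partition given by the fibers
of `p` with respect to the sub-σ-algebra `F`:
`H(P|F) = ∑_{A ∈ P} ∫ -E(1_A|F) log E(1_A|F) dμ`. -/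
noncomputable def condPartEntropy [MeasurableSpace X] (μ : Measure X)
    (F : MeasurableSpace X) {ι : Type*} [Fintype ι] (p : X → ι) : ℝ :=
  ∑ i : ι, ∫ x, Real.negMulLog ((μ[(p ⁻¹' {i}).indicator (fun _ => (1 : ℝ)) | F]) x) ∂μ

/-- The σ-algebra `σ(P^-)` generated by the partitions `T^{-n}P`, `n ≥ 1`
(the "past" of the partition given by the fibers of `p`). -/
def partPast (T : X → X) {ι : Type*} (p : X → ι) : MeasurableSpace X :=
  ⨆ n : ℕ, MeasurableSpace.comap (fun x => p (T^[n + 1] x)) ⊤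

/-- The σ-algebra `σ(P^T)` generated by the partitions `T^{-n}P`, `n ∈ ℤ`, where `S = T⁻¹`. -/
def partHull (T S : X → X) {ι : Type*} (p : X → ι) : MeasurableSpace X :=
  ⨆ n : ℕ,
    MeasurableSpace.comap (fun x => p (T^[n] x)) ⊤ ⊔
      MeasurableSpace.comap (fun x => p (S^[n] x)) ⊤

/-- Kolmogorov–Sinai entropy of a finite partition: `h_μ(P, T) = H(P | P^-)`. -/
noncomputable def partKS [MeasurableSpace X] (μ : Measure X) (T : X → X) {ι : Type*}
    [Fintype ι] (p : X → ι) : ℝ :=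
  condPartEntropy μ (partPast T p) p

/-- Kolmogorov–Sinai (measure-theoretic) entropy `h_μ(X, T)` of the system:
the supremum over all finite measurable partitions `P` of `h_μ(P, T)`. -/
noncomputable def ksEntropy [MeasurableSpace X] (μ : Measure X) (T : X → X) : ℝ≥0∞ :=
  ⨆ (k : ℕ) (p : X → Fin k) (_ : Measurable p), ENNReal.ofReal (partKS μ T p)

/-- The Pinsker σ-algebra `Π_μ`: the σ-algebra generated by all finite measurable
partitions with zero Kolmogorov–Sinai entropy. -/
def pinskerAlg [MeasurableSpace X] (μ : Measure X) (T : X → X) : MeasurableSpace X :=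
  ⨆ (k : ℕ) (p : X → Fin k) (_ : Measurable p) (_ : partKS μ T p = 0),
    MeasurableSpace.comap p ⊤

/-- Minimal cardinality of a subcover of `⋁_{i=0}^{n-1} T^{-i} C`, where `C` is a
finite cover of `X`. -/
noncomputable def coverNum (T : X → X) {k : ℕ} (C : Fin k → Set X) (n : ℕ) : ℕ :=
  sInf {m : ℕ | ∃ f : Fin m → Fin n → Fin k,
    (⋃ j : Fin m, ⋂ i : Fin n, T^[(i : ℕ)] ⁻¹' C (f j i)) = Set.univ}

/-- Topological entropy of a finite cover `C`:
`h(C, T) = inf_n (1/n) log N(⋁_{i=0}^{n-1} T^{-i} C) = lim_n (1/n) log N(...)`. -/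
noncomputable def coverEntropyOf (T : X → X) {k : ℕ} (C : Fin k → Set X) : ℝ :=
  ⨅ n : ℕ, Real.log (coverNum T C (n + 1)) / (n + 1)

/-- `(x, y)` is a topological entropy pair: `x ≠ y` and every two-set open cover
`{Uᶜ, Vᶜ}`, where `U` and `V` are disjoint closed neighbourhoods of `x` and `y`,
has positive topological entropy. -/
def IsEntropyPair [TopologicalSpace X] (T : X → X) (x y : X) : Prop :=
  x ≠ y ∧ ∀ U V : Set X, IsClosed U → IsClosed V → U ∈ 𝓝 x → V ∈ 𝓝 y → Disjoint U V →
    0 < coverEntropyOf T ![Uᶜ, Vᶜ]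

/-- `(x, y)` is an entropy pair for the invariant measure `μ`: `x ≠ y` and every two-set
Borel partition `(A, Aᶜ)` with `x ∈ interior A` and `y ∈ interior Aᶜ` has positive
entropy with respect to `T` and `μ`. -/
def IsMuEntropyPair [TopologicalSpace X] [MeasurableSpace X] (T : X → X) (μ : Measure X)
    (x y : X) : Prop :=
  x ≠ y ∧ ∀ A : Set X, MeasurableSet A → x ∈ interior A → y ∈ interior Aᶜ →
    0 < partKS μ T (fun z => if z ∈ A then (0 : Fin 2) else 1)

/-- `ν` is the relatively independent square `μ ⊠_G μ` of `μ` over the sub-σ-algebra `G`: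
it is determined by `ν(A × B) = ∫ E(1_A|G) · E(1_B|G) dμ` for all Borel sets `A`, `B`. -/
def IsCondSquare (G : MeasurableSpace X) [m0 : MeasurableSpace X] (μ : Measure X)
    (ν : Measure (X × X)) : Prop :=
  ∀ A B : Set X, MeasurableSet[m0] A → MeasurableSet[m0] B →
    ν (A ×ˢ B) = ENNReal.ofReal
      (∫ x, (μ[A.indicator (fun _ => (1 : ℝ)) | G]) x *
            (μ[B.indicator (fun _ => (1 : ℝ)) | G]) x ∂μ)

/-- The σ-algebra `m₁` is contained in `m₂` modulo `μ`-null sets. -/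
def SubModNull [MeasurableSpace X] (μ : Measure X) (m₁ m₂ : MeasurableSpace X) : Prop :=
  ∀ A : Set X, MeasurableSet[m₁] A → ∃ B : Set X, MeasurableSet[m₂] B ∧ μ (A ∆ B) = 0

end Defs

section Defs2

variable {X : Type*}

/-- The σ-algebra `F^- = ⋁_{n ≥ 1} T^{-n} F`. -/
def pastAlg (T : X → X) (F : MeasurableSpace X) : MeasurableSpace X :=
  ⨆ n : ℕ, MeasurableSpace.comap (T^[n + 1]) F

/-- The σ-algebra `F^T = ⋁_{n ∈ ℤ} T^{-n} F`, where `S = T⁻¹`. -/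
def hullAlg (T S : X → X) (F : MeasurableSpace X) : MeasurableSpace X :=
  ⨆ n : ℕ, MeasurableSpace.comap (T^[n]) F ⊔ MeasurableSpace.comap (S^[n]) F

/-- `P` is (the σ-algebra of) an *excellent* measurable partition for `(X, μ, T)` (here
`S = T⁻¹`): it is generating (`σ(P^T) = 𝒜` mod `μ`) and it is generated by an increasing
sequence of finite measurable partitions `Pₙ ↑ P` with `H(Pₙ|Pₙ⁻) − H(Pₙ|P⁻) → 0`. -/
def IsExcellentPartition (P : MeasurableSpace X) [m0 : MeasurableSpace X] (μ : Measure X)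
    (T S : X → X) : Prop :=
  P ≤ m0 ∧ SubModNull μ m0 (hullAlg T S P) ∧
  ∃ (m : ℕ → ℕ) (Q : ∀ n : ℕ, X → Fin (m n)),
    (∀ n, Measurable (Q n)) ∧
    Monotone (fun n => MeasurableSpace.comap (Q n) (⊤ : MeasurableSpace (Fin (m n)))) ∧
    (⨆ n : ℕ, MeasurableSpace.comap (Q n) (⊤ : MeasurableSpace (Fin (m n)))) = P ∧
    Tendsto (fun n => condPartEntropy μ (partPast T (Q n)) (Q n) -
      condPartEntropy μ (pastAlg T P) (Q n)) atTop (𝓝 0)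

end Defs2

open MeasureTheory Filter Topology Set
open scoped symmDiff Classical ENNReal NNReal

section Entropy

variable {X : Type*}

/-- Conditional probability of a set. -/
noncomputable def cPr {m0 : MeasurableSpace X} (μ : Measure X) (F : MeasurableSpace X)
    (A : Set X) : X → ℝ := μ[A.indicator (fun _ => (1 : ℝ)) | F]

/-- Conditional entropy with implicit ambient measurable space. -/
noncomputable def ent {m0 : MeasurableSpace X} (μ : Measure X)
    (F : MeasurableSpace X) {ι : Type*} [Fintype ι] (p : X → ι) : ℝ :=
  @condPartEntropy X m0 μ F ι _ p

theorem ent_eq {m0 : MeasurableSpace X} (μ : Measure X) (F : MeasurableSpace X)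
    {ι : Type*} [Fintype ι] (p : X → ι) :
    ent μ F p = ∑ i : ι, ∫ x, Real.negMulLog (cPr μ F (p ⁻¹' {i}) x) ∂μ := rfl

theorem integrable_ind {m0 : MeasurableSpace X} (μ : Measure X) [IsProbabilityMeasure μ]
    {A : Set X} (hA : MeasurableSet[m0] A) : Integrable (A.indicator (fun _ => (1 : ℝ))) μ :=
  (integrable_const (1 : ℝ)).indicator hA

theorem cPr_mem {m0 : MeasurableSpace X} (μ : Measure X) [IsProbabilityMeasure μ]
    {F : MeasurableSpace X} (hF : F ≤ m0) {A : Set X} (hA : MeasurableSet[m0] A) :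
    ∀ᵐ x ∂μ, cPr μ F A x ∈ Icc (0 : ℝ) 1 := by
  refine Convex.condExp_mem hF (integrable_ind μ hA) isClosed_Icc (convex_Icc 0 1) ?_
  refine Eventually.of_forall fun x => ?_
  by_cases h : x ∈ A <;> simp [h]

theorem integrable_comp_of_mem {m0 : MeasurableSpace X} (μ : Measure X) [IsProbabilityMeasure μ]
    {g : X → ℝ} (hg : AEStronglyMeasurable g μ) (hm : ∀ᵐ x ∂μ, g x ∈ Icc (0 : ℝ) 1)
    {φ : ℝ → ℝ} (hφ : Continuous φ) : Integrable (fun x => φ (g x)) μ := by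
  obtain ⟨C, hC⟩ := (isCompact_Icc (a := (0:ℝ)) (b := 1)).exists_bound_of_continuousOn
    hφ.continuousOn
  refine Integrable.mono' (integrable_const C) (hφ.comp_aestronglyMeasurable hg) ?_
  filter_upwards [hm] with x hx using hC _ hx

theorem aesm_cPr {m0 : MeasurableSpace X} (μ : Measure X) (F : MeasurableSpace X)
    (A : Set X) : AEStronglyMeasurable[m0] (cPr μ F A) μ :=
  integrable_condExp.aestronglyMeasurable

theorem integrable_eta {m0 : MeasurableSpace X} (μ : Measure X) [IsProbabilityMeasure μ]
    {F : MeasurableSpace X} (hF : F ≤ m0) {A : Set X} (hA : MeasurableSet[m0] A) :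
    Integrable (fun x => Real.negMulLog (cPr μ F A x)) μ :=
  integrable_comp_of_mem μ (aesm_cPr μ F A) (cPr_mem μ hF hA) Real.continuous_negMulLog

theorem ent_nonneg {m0 : MeasurableSpace X} (μ : Measure X) [IsProbabilityMeasure μ]
    {F : MeasurableSpace X} (hF : F ≤ m0) {ι : Type*} [Fintype ι] {p : X → ι}
    (hp : MeasurableSpace.comap p ⊤ ≤ m0) : 0 ≤ ent μ F p := by
  refine Finset.sum_nonneg fun i _ => integral_nonneg_of_ae ?_
  filter_upwards [cPr_mem μ hF (hp _ ⟨{i}, trivial, rfl⟩)] with x hx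
  exact Real.negMulLog_nonneg hx.1 hx.2

theorem convexOn_phi : ConvexOn ℝ (Icc (0 : ℝ) 1)
    (fun x => -(Real.negMulLog x + x ^ 2 / 2)) := by
  have hd : ∀ x ∈ interior (Icc (0 : ℝ) 1), HasDerivAt
      (fun x => -(Real.negMulLog x + x ^ 2 / 2)) (Real.log x + 1 - x) x := by
    intro x hx
    rw [interior_Icc] at hx
    have h := ((Real.hasDerivAt_negMulLog hx.1.ne').add ((hasDerivAt_pow 2 x).div_const 2)).neg
    have e : -(-Real.log x - 1 + ((2 : ℕ) : ℝ) * x ^ (2 - 1) / 2) = Real.log x + 1 - x := by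
      norm_num
      ring
    rw [e] at h
    exact h
  have hd2 : ∀ x ∈ interior (Icc (0 : ℝ) 1), HasDerivAt
      (fun x => Real.log x + 1 - x) (x⁻¹ - 1) x := by
    intro x hx
    rw [interior_Icc] at hx
    exact ((Real.hasDerivAt_log hx.1.ne').add_const 1).sub (hasDerivAt_id x)
  refine convexOn_of_hasDerivWithinAt2_nonneg (convex_Icc 0 1) (by fun_prop)
    (fun x hx => (hd x hx).hasDerivWithinAt) (fun x hx => (hd2 x hx).hasDerivWithinAt) ?_
  intro x hx
  rw [interior_Icc] at hx
  have := (one_le_inv₀ hx.1).2 hx.2.le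
  linarith

/-- Strong concavity: one-set version. -/
theorem eta_strong {m0 : MeasurableSpace X} (μ : Measure X) [IsProbabilityMeasure μ]
    {F G : MeasurableSpace X} (hFG : F ≤ G) (hG : G ≤ m0) {A : Set X}
    (hA : MeasurableSet[m0] A) :
    ∫ x, Real.negMulLog (cPr μ G A x) ∂μ + (∫ x, (cPr μ G A x - cPr μ F A x) ^ 2 ∂μ) / 2
      ≤ ∫ x, Real.negMulLog (cPr μ F A x) ∂μ := by
  have hF := hFG.trans hG
  set g := cPr μ G A with hg
  set f := cPr μ F A with hf
  have htower : μ[g | F] =ᵐ[μ] f := condExp_condExp_of_le hFG hG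
  have hgm := cPr_mem μ hG hA
  have hfm := cPr_mem μ hF hA
  have hgs := aesm_cPr μ G A
  have hfs := aesm_cPr μ F A
  set φ : ℝ → ℝ := fun x => -(Real.negMulLog x + x ^ 2 / 2) with hφ
  have hφc : Continuous φ := by fun_prop
  have hgint : Integrable g μ := integrable_condExp
  have hfint : Integrable f μ := integrable_condExp
  have J := ConvexOn.map_condExp_le (μ := μ) hF convexOn_phi
    hφc.continuousOn.lowerSemicontinuousOn hgm isClosed_Icc hgint
    (integrable_comp_of_mem μ hgs hgm hφc)
  have J2 : ∫ x, φ (f x) ∂μ ≤ ∫ x, φ (g x) ∂μ := by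
    rw [← integral_condExp hF (f := fun x => φ (g x))]
    refine integral_mono_ae (integrable_comp_of_mem μ hfs hfm hφc) integrable_condExp ?_
    filter_upwards [J, htower] with x h1 h2
    have h1' : φ ((μ[g | F]) x) ≤ (μ[fun x => φ (g x) | F]) x := h1
    rwa [h2] at h1'
  have hη : Continuous Real.negMulLog := Real.continuous_negMulLog
  have hsq : Continuous (fun x : ℝ => x ^ 2 / 2) := by fun_prop
  have i1 := integrable_comp_of_mem μ hgs hgm hη
  have i2 := integrable_comp_of_mem μ hgs hgm hsq
  have i3 := integrable_comp_of_mem μ hfs hfm hη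
  have i4 := integrable_comp_of_mem μ hfs hfm hsq
  have e1 : ∫ x, φ (g x) ∂μ = -(∫ x, Real.negMulLog (g x) ∂μ + ∫ x, (g x) ^ 2 / 2 ∂μ) := by
    rw [← integral_add i1 i2, ← integral_neg]
  have e2 : ∫ x, φ (f x) ∂μ = -(∫ x, Real.negMulLog (f x) ∂μ + ∫ x, (f x) ^ 2 / 2 ∂μ) := by
    rw [← integral_add i3 i4, ← integral_neg]
  -- Pythagoras
  have ifg : Integrable (fun x => f x * g x) μ := by
    refine Integrable.bdd_mul (c := 1) hgint hfs ?_
    filter_upwards [hfm] with x hx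
    rw [Real.norm_eq_abs, abs_of_nonneg hx.1]; exact hx.2
  have e3 : ∫ x, f x * g x ∂μ = ∫ x, f x ^ 2 ∂μ := by
    rw [← integral_condExp hF (f := fun x => f x * g x)]
    refine integral_congr_ae ?_
    have := condExp_mul_of_stronglyMeasurable_left (μ := μ) (m := F) (f := f) (g := g)
      stronglyMeasurable_condExp ifg hgint
    filter_upwards [this, htower] with x h1 h2
    have h1' : (μ[fun x => f x * g x | F]) x = f x * (μ[g | F]) x := h1
    rw [h1', h2]; ring
  have i5 : Integrable (fun x => f x ^ 2) μ := by
    simpa using (i4.mul_const 2)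
  have i6 : Integrable (fun x => g x ^ 2) μ := by
    simpa using (i2.mul_const 2)
  have e4 : ∫ x, (g x - f x) ^ 2 ∂μ = ∫ x, g x ^ 2 ∂μ - ∫ x, f x ^ 2 ∂μ := by
    have : (fun x => (g x - f x) ^ 2) = fun x => (g x ^ 2 - 2 * (f x * g x)) + f x ^ 2 := by
      funext x; ring
    have i7 : Integrable (fun x => g x ^ 2 - 2 * (f x * g x)) μ := i6.sub (ifg.const_mul 2)
    rw [this, integral_add i7 i5, integral_sub i6 (ifg.const_mul 2),
      integral_const_mul, e3]
    ring
  have e5 : ∫ x, (g x) ^ 2 / 2 ∂μ = (∫ x, (g x) ^ 2 ∂μ) / 2 := integral_div _ _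
  have e6 : ∫ x, (f x) ^ 2 / 2 ∂μ = (∫ x, (f x) ^ 2 ∂μ) / 2 := integral_div _ _
  rw [e1, e2, e5, e6] at J2
  rw [e4]
  linarith

theorem ent_anti {m0 : MeasurableSpace X} (μ : Measure X) [IsProbabilityMeasure μ]
    {F G : MeasurableSpace X} (hFG : F ≤ G) (hG : G ≤ m0) {ι : Type*} [Fintype ι] {p : X → ι}
    (hp : MeasurableSpace.comap p ⊤ ≤ m0) : ent μ G p ≤ ent μ F p := by
  refine Finset.sum_le_sum fun i _ => ?_
  have := eta_strong μ hFG hG (hp _ ⟨{i}, trivial, rfl⟩)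
  have h2 : 0 ≤ ∫ x, (cPr μ G (p ⁻¹' {i}) x - cPr μ F (p ⁻¹' {i}) x) ^ 2 ∂μ :=
    integral_nonneg fun x => sq_nonneg _
  simp only [cPr] at this h2
  linarith

theorem cPr_eq_of_ent_eq {m0 : MeasurableSpace X} (μ : Measure X) [IsProbabilityMeasure μ]
    {F G : MeasurableSpace X} (hFG : F ≤ G) (hG : G ≤ m0) {ι : Type*} [Fintype ι] {p : X → ι}
    (hp : MeasurableSpace.comap p ⊤ ≤ m0) (h : ent μ F p ≤ ent μ G p)
    (i : ι) : cPr μ G (p ⁻¹' {i}) =ᵐ[μ] cPr μ F (p ⁻¹' {i}) := by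
  have hA : ∀ i, MeasurableSet[m0] (p ⁻¹' {i}) := fun i => hp _ ⟨{i}, trivial, rfl⟩
  have hs : ∀ i, 0 ≤ ∫ x, (cPr μ G (p ⁻¹' {i}) x - cPr μ F (p ⁻¹' {i}) x) ^ 2 ∂μ :=
    fun i => integral_nonneg fun x => sq_nonneg _
  rw [ent_eq, ent_eq] at h
  have hle : ∀ j, ∫ x, Real.negMulLog (cPr μ G (p ⁻¹' {j}) x) ∂μ ≤
      ∫ x, Real.negMulLog (cPr μ F (p ⁻¹' {j}) x) ∂μ := fun j => by
    linarith [eta_strong μ hFG hG (hA j), hs j]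
  have heq := (Finset.sum_eq_sum_iff_of_le (fun j (_ : j ∈ Finset.univ) => hle j)).1
    (le_antisymm (Finset.sum_le_sum fun j _ => hle j) h) i (Finset.mem_univ i)
  have hz : ∫ x, (cPr μ G (p ⁻¹' {i}) x - cPr μ F (p ⁻¹' {i}) x) ^ 2 ∂μ = 0 :=
    le_antisymm (by linarith [eta_strong μ hFG hG (hA i)]) (hs i)
  have hF := hFG.trans hG
  have hint : Integrable (fun x => (cPr μ G (p ⁻¹' {i}) x - cPr μ F (p ⁻¹' {i}) x) ^ 2) μ := by
    refine Integrable.mono' (integrable_const 1)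
      (((aesm_cPr μ G _).sub (aesm_cPr μ F _)).pow 2) ?_
    filter_upwards [cPr_mem μ hG (hA i), cPr_mem μ hF (hA i)] with x h1 h2
    rw [Real.norm_eq_abs, abs_of_nonneg (sq_nonneg _)]
    have := h1.1; have := h1.2; have := h2.1; have := h2.2
    nlinarith
  rw [integral_eq_zero_iff_of_nonneg (fun x => sq_nonneg _) hint] at hz
  filter_upwards [hz] with x hx
  have : cPr μ G (p ⁻¹' {i}) x - cPr μ F (p ⁻¹' {i}) x = 0 := by simpa using hx
  linarith

theorem cPr_tendsto {m0 : MeasurableSpace X} (μ : Measure X) [IsProbabilityMeasure μ]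
    {F : ℕ → MeasurableSpace X} (hF : Monotone F) (hFm : ∀ n, F n ≤ m0) (A : Set X) :
    ∀ᵐ x ∂μ, Tendsto (fun n => cPr μ (F n) A x) atTop (𝓝 (cPr μ (⨆ n, F n) A x)) := by
  let ℱ : Filtration ℕ m0 := ⟨F, hF, hFm⟩
  exact MeasureTheory.tendsto_ae_condExp (ℱ := ℱ) (μ := μ) (A.indicator (fun _ => (1 : ℝ)))

theorem ent_tendsto {m0 : MeasurableSpace X} (μ : Measure X) [IsProbabilityMeasure μ]
    {F : ℕ → MeasurableSpace X} (hF : Monotone F) (hFm : ∀ n, F n ≤ m0)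
    {ι : Type*} [Fintype ι] {p : X → ι} (hp : MeasurableSpace.comap p ⊤ ≤ m0) :
    Tendsto (fun n => ent μ (F n) p) atTop
      (𝓝 (ent μ (⨆ n, F n) p)) := by
  refine tendsto_finsetSum _ fun i _ => ?_
  have hA : MeasurableSet[m0] (p ⁻¹' {i}) := hp _ ⟨{i}, trivial, rfl⟩
  obtain ⟨C, hC⟩ := (isCompact_Icc (a := (0:ℝ)) (b := 1)).exists_bound_of_continuousOn
    Real.continuous_negMulLog.continuousOn
  refine tendsto_integral_of_dominated_convergence (fun _ => C) (fun n => ?_)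
    (integrable_const C) (fun n => ?_) ?_
  · exact Real.continuous_negMulLog.comp_aestronglyMeasurable (aesm_cPr μ (F n) _)
  · filter_upwards [cPr_mem μ (hFm n) hA] with x hx using hC _ hx
  · filter_upwards [cPr_tendsto μ hF hFm (p ⁻¹' {i})] with x hx
    exact (Real.continuous_negMulLog.tendsto _).comp hx

end Entropy

open MeasureTheory Filter Topology Set
open scoped symmDiff Classical ENNReal NNReal

section Chain

variable {X : Type*}

theorem sup_rep {F : MeasurableSpace X} {κ : Type*} (q : X → κ) {s : Set X}
    (hs : MeasurableSet[F ⊔ MeasurableSpace.comap q ⊤] s) :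
    ∃ S : κ → Set X, (∀ j, MeasurableSet[F] (S j)) ∧ s = {x | x ∈ S (q x)} := by
  let M : MeasurableSpace X :=
    { MeasurableSet' := fun s => ∃ S : κ → Set X, (∀ j, MeasurableSet[F] (S j)) ∧
        s = {x | x ∈ S (q x)}
      measurableSet_empty := ⟨fun _ => ∅, fun _ => @MeasurableSet.empty _ F, by ext; simp⟩
      measurableSet_compl := by
        rintro s ⟨S, hS, rfl⟩
        exact ⟨fun j => (S j)ᶜ, fun j => (hS j).compl, by ext; simp⟩
      measurableSet_iUnion := by
        intro f hf
        choose S hS hfS using hf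
        refine ⟨fun j => ⋃ n, S n j, fun j => MeasurableSet.iUnion fun n => hS n j, ?_⟩
        ext x
        simp only [mem_iUnion, mem_ofPred_eq]
        refine exists_congr fun n => ?_
        rw [hfS n]; rfl }
  have h1 : F ≤ M := fun s hs => ⟨fun _ => s, fun _ => hs, rfl⟩
  have h2 : MeasurableSpace.comap q ⊤ ≤ M := by
    rintro s ⟨t, -, rfl⟩
    refine ⟨fun j => {x | j ∈ t}, fun j => ?_, rfl⟩
    by_cases h : j ∈ t <;> simp [h]
  exact (sup_le h1 h2) s hs

/-- Testing the conditional probability against bounded measurable functions. -/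
theorem test_cPr {m0 : MeasurableSpace X} (μ : Measure X) [IsProbabilityMeasure μ]
    {F : MeasurableSpace X} (hF : F ≤ m0) {B : Set X} (hB : MeasurableSet[m0] B)
    {w : X → ℝ} (hw : StronglyMeasurable[F] w) {C : ℝ} (hC : ∀ᵐ x ∂μ, ‖w x‖ ≤ C) :
    ∫ x, w x * B.indicator (fun _ => (1 : ℝ)) x ∂μ = ∫ x, w x * cPr μ F B x ∂μ := by
  have hi : Integrable (fun x => w x * B.indicator (fun _ => (1 : ℝ)) x) μ :=
    Integrable.bdd_mul (c := C) (integrable_ind μ hB) (hw.mono hF).aestronglyMeasurable hC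
  rw [← integral_condExp hF (f := fun x => w x * B.indicator (fun _ => (1 : ℝ)) x)]
  exact integral_congr_ae (condExp_mul_of_stronglyMeasurable_left hw hi (integrable_ind μ hB))

theorem test_cPr_set {m0 : MeasurableSpace X} (μ : Measure X) [IsProbabilityMeasure μ]
    {F : MeasurableSpace X} (hF : F ≤ m0) {B : Set X} (hB : MeasurableSet[m0] B)
    {w : X → ℝ} (hw : StronglyMeasurable[F] w) {C : ℝ} (hC : ∀ᵐ x ∂μ, ‖w x‖ ≤ C)
    {S : Set X} (hS : MeasurableSet[F] S) :
    ∫ x in S, w x * B.indicator (fun _ => (1 : ℝ)) x ∂μ = ∫ x in S, w x * cPr μ F B x ∂μ := by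
  have h := test_cPr μ hF hB (hw.indicator hS) (C := C) (by
    filter_upwards [hC] with x hx
    exact (norm_indicator_le_norm_self _ _).trans hx)
  rw [← integral_indicator (hF _ hS), ← integral_indicator (hF _ hS)]
  convert h using 2 <;>
  · funext x
    by_cases hx : x ∈ S <;> simp [hx]

theorem cPr_mono_set {m0 : MeasurableSpace X} (μ : Measure X) [IsProbabilityMeasure μ]
    (F : MeasurableSpace X) {A B : Set X} (hA : MeasurableSet[m0] A)
    (hB : MeasurableSet[m0] B) (hAB : A ⊆ B) : cPr μ F A ≤ᵐ[μ] cPr μ F B :=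
  condExp_mono (integrable_ind μ hA) (integrable_ind μ hB)
    (Eventually.of_forall fun x => indicator_le_indicator_of_subset hAB (fun _ => zero_le_one) x)

theorem eta_div {f g : ℝ} (h0 : 0 ≤ f) (hfg : f ≤ g) :
    Real.negMulLog (f / g) * g = Real.negMulLog f + f * Real.log g := by
  rcases eq_or_lt_of_le h0 with h | h
  · simp [← h]
  · have hg : 0 < g := h.trans_le hfg
    rw [Real.negMulLog, Real.negMulLog, Real.log_div h.ne' hg.ne']
    field_simp
    ring

theorem cPr_sup {m0 : MeasurableSpace X} (μ : Measure X) [IsProbabilityMeasure μ]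
    {F : MeasurableSpace X} (hF : F ≤ m0) {κ : Type*} [Fintype κ] {q : X → κ}
    (hq : MeasurableSpace.comap q ⊤ ≤ m0) {A : Set X} (hA : MeasurableSet[m0] A) :
    (fun x => cPr μ F (A ∩ q ⁻¹' {q x}) x / cPr μ F (q ⁻¹' {q x}) x) =ᵐ[μ]
      cPr μ (F ⊔ MeasurableSpace.comap q ⊤) A := by
  have hB : ∀ j, MeasurableSet[m0] (q ⁻¹' {j}) := fun j => hq _ ⟨{j}, trivial, rfl⟩
  set w : κ → X → ℝ := fun j x => cPr μ F (A ∩ q ⁻¹' {j}) x / cPr μ F (q ⁻¹' {j}) x with hw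
  have hwm : ∀ j, StronglyMeasurable[F] (w j) := fun j =>
    (stronglyMeasurable_condExp.measurable.div
      stronglyMeasurable_condExp.measurable).stronglyMeasurable
  have hwb : ∀ j, ∀ᵐ x ∂μ, ‖w j x‖ ≤ 1 := by
    intro j
    filter_upwards [cPr_mem μ hF (hA.inter (hB j)), cPr_mem μ hF (hB j),
      cPr_mono_set μ F (hA.inter (hB j)) (hB j) inter_subset_right] with x h1 h2 h3
    rw [Real.norm_eq_abs, abs_of_nonneg (div_nonneg h1.1 h2.1)]
    exact div_le_one_of_le₀ h3 h2.1
  have hsup : F ⊔ MeasurableSpace.comap q ⊤ ≤ m0 := sup_le hF hq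
  set u : X → ℝ := fun x => w (q x) x with hu
  have husum : u = fun x => ∑ j, w j x * (q ⁻¹' {j}).indicator (fun _ => (1 : ℝ)) x := by
    funext x
    rw [Finset.sum_eq_single (q x)]
    · simp [hu]
    · intro j _ hj
      have : x ∉ q ⁻¹' {j} := fun h => hj h.symm
      simp [this]
    · simp
  have hum : StronglyMeasurable[F ⊔ MeasurableSpace.comap q ⊤] u := by
    rw [husum]
    refine Finset.stronglyMeasurable_fun_sum _ fun j _ => ?_
    refine StronglyMeasurable.mul
      ((hwm j).mono (le_sup_left : F ≤ F ⊔ MeasurableSpace.comap q ⊤)) ?_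
    refine stronglyMeasurable_const.indicator ?_
    exact (le_sup_right : MeasurableSpace.comap q ⊤ ≤ F ⊔ MeasurableSpace.comap q ⊤) _
      ⟨{j}, trivial, rfl⟩
  have hterm : ∀ j, Integrable (fun x => w j x * (q ⁻¹' {j}).indicator (fun _ => (1 : ℝ)) x) μ :=
    fun j => Integrable.bdd_mul (c := 1) (integrable_ind μ (hB j))
      ((hwm j).mono hF).aestronglyMeasurable (hwb j)
  have huint : Integrable u μ := by
    rw [husum]
    exact integrable_finsetSum _ fun j _ => hterm j
  refine ae_eq_condExp_of_forall_setIntegral_eq hsup (integrable_ind μ hA)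
    (fun s _ _ => huint.integrableOn) ?_ hum.aestronglyMeasurable
  intro s hs _
  obtain ⟨S, hS, hsS⟩ := sup_rep q hs
  have hsm := hsup _ hs
  have hSm : ∀ j, MeasurableSet[m0] (S j) := fun j => hF _ (hS j)
  have hsj : ∀ j, s ∩ q ⁻¹' {j} = S j ∩ q ⁻¹' {j} := by
    intro j; ext x
    simp only [hsS, mem_inter_iff, mem_ofPred_eq, mem_preimage, mem_singleton_iff]
    constructor
    · rintro ⟨h1, rfl⟩; exact ⟨h1, rfl⟩
    · rintro ⟨h1, rfl⟩; exact ⟨h1, rfl⟩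
  -- both sides are sums over j
  have L : ∫ x in s, u x ∂μ = ∑ j, ∫ x in S j, cPr μ F (A ∩ q ⁻¹' {j}) x ∂μ := by
    rw [husum, integral_finsetSum _ fun j _ => (hterm j).integrableOn]
    refine Finset.sum_congr rfl fun j _ => ?_
    have e1 : ∫ x in s, w j x * (q ⁻¹' {j}).indicator (fun _ => (1 : ℝ)) x ∂μ =
        ∫ x in S j, w j x * (q ⁻¹' {j}).indicator (fun _ => (1 : ℝ)) x ∂μ := by
      rw [← integral_indicator hsm, ← integral_indicator (hSm j)]
      congr 1
      funext x
      by_cases hx : x ∈ q ⁻¹' {j}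
      · have : x ∈ s ↔ x ∈ S j := by
          have := Set.ext_iff.1 (hsj j) x
          simpa [hx] using this
        by_cases hs' : x ∈ s
        · rw [indicator_of_mem hs', indicator_of_mem (this.1 hs')]
        · rw [indicator_of_notMem hs', indicator_of_notMem (fun h => hs' (this.2 h))]
      · simp only [indicator_apply, hx]; simp
    rw [e1, test_cPr_set μ hF (hB j) (hwm j) (hwb j) (hS j)]
    refine setIntegral_congr_ae (hSm j) ?_
    filter_upwards [cPr_mem μ hF (hA.inter (hB j)), cPr_mem μ hF (hB j),
      cPr_mono_set μ F (hA.inter (hB j)) (hB j) inter_subset_right] with x h1 h2 h3 _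
    by_cases hz : cPr μ F (q ⁻¹' {j}) x = 0
    · have : cPr μ F (A ∩ q ⁻¹' {j}) x = 0 := le_antisymm (hz ▸ h3) h1.1
      simp [hw, hz, this]
    · exact div_mul_cancel₀ _ hz
  have R : ∫ x in s, A.indicator (fun _ => (1 : ℝ)) x ∂μ =
      ∑ j, ∫ x in S j, cPr μ F (A ∩ q ⁻¹' {j}) x ∂μ := by
    have e : A.indicator (fun _ => (1 : ℝ)) =
        fun x => ∑ j, (A ∩ q ⁻¹' {j}).indicator (fun _ => (1 : ℝ)) x := by
      funext x
      rw [Finset.sum_eq_single (q x)]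
      · simp [indicator_apply]
      · intro j _ hj
        have : x ∉ q ⁻¹' {j} := fun h => hj h.symm
        simp [this]
      · simp
    rw [e, integral_finsetSum _ fun j _ => (integrable_ind μ (hA.inter (hB j))).integrableOn]
    refine Finset.sum_congr rfl fun j _ => ?_
    have e2 := setIntegral_condExp hF (integrable_ind μ (hA.inter (hB j))) (hS j)
    refine Eq.trans ?_ e2.symm
    rw [← integral_indicator hsm, ← integral_indicator (hSm j)]
    congr 1
    funext x
    by_cases hx : x ∈ q ⁻¹' {j}
    · have : x ∈ s ↔ x ∈ S j := by
        have := Set.ext_iff.1 (hsj j) x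
        simpa [hx] using this
      by_cases hs' : x ∈ s
      · rw [indicator_of_mem hs', indicator_of_mem (this.1 hs')]
      · rw [indicator_of_notMem hs', indicator_of_notMem (fun h => hs' (this.2 h))]
    · simp only [indicator_apply, mem_inter_iff, hx]; simp
  rw [L, R]

theorem ent_pair {m0 : MeasurableSpace X} (μ : Measure X) [IsProbabilityMeasure μ]
    {F : MeasurableSpace X} (hF : F ≤ m0) {ι κ : Type*} [Fintype ι] [Fintype κ]
    {p : X → ι} {q : X → κ} (hp : MeasurableSpace.comap p ⊤ ≤ m0)
    (hq : MeasurableSpace.comap q ⊤ ≤ m0) :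
    ent μ F (fun x => (p x, q x)) =
      ent μ F q + ent μ (F ⊔ MeasurableSpace.comap q ⊤) p := by
  have hA : ∀ j, MeasurableSet[m0] (p ⁻¹' {j}) := fun j => hp _ ⟨{j}, trivial, rfl⟩
  have hB : ∀ j, MeasurableSet[m0] (q ⁻¹' {j}) := fun j => hq _ ⟨{j}, trivial, rfl⟩
  set f : ι → κ → X → ℝ := fun i j => cPr μ F (p ⁻¹' {i} ∩ q ⁻¹' {j}) with hf
  set g : κ → X → ℝ := fun j => cPr μ F (q ⁻¹' {j}) with hg
  have hfg : ∀ i j, f i j ≤ᵐ[μ] g j := fun i j =>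
    cPr_mono_set μ F ((hA i).inter (hB j)) (hB j) inter_subset_right
  have hf0 : ∀ i j, ∀ᵐ x ∂μ, f i j x ∈ Icc (0 : ℝ) 1 := fun i j =>
    cPr_mem μ hF ((hA i).inter (hB j))
  have hg0 : ∀ j, ∀ᵐ x ∂μ, g j x ∈ Icc (0 : ℝ) 1 := fun j => cPr_mem μ hF (hB j)
  have hwm : ∀ i j, StronglyMeasurable[F] (fun x => f i j x / g j x) := fun i j =>
    (stronglyMeasurable_condExp.measurable.div
      stronglyMeasurable_condExp.measurable).stronglyMeasurable
  have hw01 : ∀ i j, ∀ᵐ x ∂μ, f i j x / g j x ∈ Icc (0 : ℝ) 1 := by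
    intro i j
    filter_upwards [hf0 i j, hg0 j, hfg i j] with x h1 h2 h3
    exact ⟨div_nonneg h1.1 h2.1, div_le_one_of_le₀ h3 h2.1⟩
  obtain ⟨C, hC⟩ := (isCompact_Icc (a := (0:ℝ)) (b := 1)).exists_bound_of_continuousOn
    Real.continuous_negMulLog.continuousOn
  have hηm : ∀ i j, StronglyMeasurable[F] (fun x => Real.negMulLog (f i j x / g j x)) :=
    fun i j => Real.continuous_negMulLog.comp_stronglyMeasurable (hwm i j)
  have hηb : ∀ i j, ∀ᵐ x ∂μ, ‖Real.negMulLog (f i j x / g j x)‖ ≤ C := by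
    intro i j
    filter_upwards [hw01 i j] with x hx using hC _ hx
  have hηi : ∀ i j, Integrable (fun x => Real.negMulLog (f i j x / g j x) *
      (q ⁻¹' {j}).indicator (fun _ => (1 : ℝ)) x) μ := fun i j =>
    Integrable.bdd_mul (c := C) (integrable_ind μ (hB j))
      ((hηm i j).mono hF).aestronglyMeasurable (hηb i j)
  have hηg : ∀ i j, Integrable (fun x => Real.negMulLog (f i j x / g j x) * g j x) μ :=
    fun i j => Integrable.bdd_mul (c := C) integrable_condExp
      ((hηm i j).mono hF).aestronglyMeasurable (hηb i j)
  -- the conditional term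
  have E1 : ∀ i, ∫ x, Real.negMulLog (cPr μ (F ⊔ MeasurableSpace.comap q ⊤) (p ⁻¹' {i}) x) ∂μ
      = ∑ j, ∫ x, Real.negMulLog (f i j x / g j x) * g j x ∂μ := by
    intro i
    have e : ∀ᵐ x ∂μ, Real.negMulLog
        (cPr μ (F ⊔ MeasurableSpace.comap q ⊤) (p ⁻¹' {i}) x) =
        ∑ j, Real.negMulLog (f i j x / g j x) *
          (q ⁻¹' {j}).indicator (fun _ => (1 : ℝ)) x := by
      filter_upwards [cPr_sup μ hF hq (hA i)] with x hx
      rw [← hx, Finset.sum_eq_single (q x)]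
      · simp [hf, hg]
      · intro j _ hj
        have : x ∉ q ⁻¹' {j} := fun h => hj h.symm
        simp [this]
      · simp
    rw [integral_congr_ae e, integral_finsetSum _ fun j _ => hηi i j]
    exact Finset.sum_congr rfl fun j _ => test_cPr μ hF (hB j) (hηm i j) (hηb i j)
  have E2 : ∀ j, ∑ i, ∫ x, Real.negMulLog (f i j x / g j x) * g j x ∂μ =
      ∑ i, ∫ x, Real.negMulLog (f i j x) ∂μ - ∫ x, Real.negMulLog (g j x) ∂μ := by
    intro j
    have hsum : ∀ᵐ x ∂μ, ∑ i, f i j x = g j x := by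
      have h1 := condExp_finsetSum (μ := μ) (s := Finset.univ)
        (f := fun i => (p ⁻¹' {i} ∩ q ⁻¹' {j}).indicator (fun _ => (1 : ℝ)))
        (fun i _ => integrable_ind μ ((hA i).inter (hB j))) F
      have h2 : (∑ i, (p ⁻¹' {i} ∩ q ⁻¹' {j}).indicator (fun _ => (1 : ℝ))) =
          (q ⁻¹' {j}).indicator (fun _ => (1 : ℝ)) := by
        funext x
        rw [Finset.sum_apply, Finset.sum_eq_single (p x)]
        · simp [indicator_apply]
        · intro i _ hi
          have : x ∉ p ⁻¹' {i} := fun h => hi h.symm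
          simp [this]
        · simp
      rw [h2] at h1
      filter_upwards [h1] with x hx
      rw [Finset.sum_apply] at hx
      exact hx.symm
    rw [← integral_finsetSum _ fun i _ => hηg i j,
      ← integral_finsetSum _ fun i _ => integrable_eta μ hF ((hA i).inter (hB j)),
      ← integral_sub (integrable_finsetSum _ fun i _ =>
        integrable_eta μ hF ((hA i).inter (hB j))) (integrable_eta μ hF (hB j))]
    refine integral_congr_ae ?_
    have hall1 : ∀ᵐ x ∂μ, ∀ i, f i j x ∈ Icc (0 : ℝ) 1 := ae_all_iff.2 fun i => hf0 i j
    have hall2 : ∀ᵐ x ∂μ, ∀ i, f i j x ≤ g j x := ae_all_iff.2 fun i => hfg i j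
    filter_upwards [hsum, hall1, hall2] with x h1 h2 h3
    rw [Finset.sum_congr rfl fun i _ => eta_div (h2 i).1 (h3 i), Finset.sum_add_distrib,
      ← Finset.sum_mul, h1]
    simp only [Real.negMulLog, hf, hg]
    ring
  rw [ent_eq μ (F ⊔ MeasurableSpace.comap q ⊤), Finset.sum_congr rfl fun i _ => E1 i,
    Finset.sum_comm, Finset.sum_congr rfl fun j _ => E2 j, Finset.sum_sub_distrib, ent_eq, ent_eq,
    Fintype.sum_prod_type_right]
  have : ∀ i j, (fun x => (p x, q x)) ⁻¹' {(i, j)} = p ⁻¹' {i} ∩ q ⁻¹' {j} := by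
    intro i j; ext x; simp
  simp only [this]
  ring

theorem cPr_of_ae {m0 : MeasurableSpace X} (μ : Measure X) [IsProbabilityMeasure μ]
    {F : MeasurableSpace X} (hF : F ≤ m0) {A B : Set X} (hB : MeasurableSet[F] B)
    (hAB : A =ᵐ[μ] B) : cPr μ F A =ᵐ[μ] A.indicator (fun _ => (1 : ℝ)) := by
  have h1 : A.indicator (fun _ => (1 : ℝ)) =ᵐ[μ] B.indicator (fun _ => (1 : ℝ)) :=
    @indicator_ae_eq_of_ae_eq_set _ _ m0 _ _ _ _ _ hAB
  have h2 : cPr μ F A =ᵐ[μ] cPr μ F B := condExp_congr_ae h1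
  have h3 : cPr μ F B = B.indicator (fun _ => (1 : ℝ)) :=
    condExp_of_stronglyMeasurable hF (stronglyMeasurable_const.indicator hB)
      (integrable_ind μ (hF _ hB))
  rw [h3] at h2
  exact h2.trans h1.symm

theorem ent_zero_ae {m0 : MeasurableSpace X} (μ : Measure X) [IsProbabilityMeasure μ]
    {F : MeasurableSpace X} (hF : F ≤ m0) {ι : Type*} [Fintype ι] {p : X → ι}
    (h : ∀ i, ∃ B, MeasurableSet[F] B ∧ p ⁻¹' {i} =ᵐ[μ] B) : ent μ F p = 0 := by
  rw [ent_eq]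
  refine Finset.sum_eq_zero fun i _ => integral_eq_zero_of_ae ?_
  obtain ⟨B, hB, hAB⟩ := h i
  filter_upwards [cPr_of_ae μ hF hB hAB] with x hx
  rw [hx]
  by_cases hx' : x ∈ p ⁻¹' {i}
  · rw [indicator_of_mem hx']; simp
  · rw [indicator_of_notMem hx']; simp

theorem ent_zero {m0 : MeasurableSpace X} (μ : Measure X) [IsProbabilityMeasure μ]
    {F : MeasurableSpace X} (hF : F ≤ m0) {ι : Type*} [Fintype ι] {p : X → ι}
    (h : MeasurableSpace.comap p ⊤ ≤ F) : ent μ F p = 0 :=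
  ent_zero_ae μ hF fun i => ⟨p ⁻¹' {i}, h _ ⟨{i}, trivial, rfl⟩, EventuallyEq.rfl⟩

theorem ent_swap {m0 : MeasurableSpace X} (μ : Measure X)
    (F : MeasurableSpace X) {ι κ : Type*} [Fintype ι] [Fintype κ]
    (p : X → ι) (q : X → κ) :
    ent μ F (fun x => (p x, q x)) = ent μ F (fun x => (q x, p x)) := by
  rw [ent_eq, ent_eq]
  refine Fintype.sum_equiv (Equiv.prodComm ι κ) _ _ ?_
  rintro ⟨i, j⟩
  have : (fun x => (p x, q x)) ⁻¹' {(i, j)} =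
      (fun x => (q x, p x)) ⁻¹' {(Equiv.prodComm ι κ) (i, j)} := by
    ext x; simp [and_comm]
  rw [this]

theorem ent_congr {m0 : MeasurableSpace X} (μ : Measure X) [IsProbabilityMeasure μ]
    {F : MeasurableSpace X} (hF : F ≤ m0) {ι κ : Type*} [Fintype ι] [Fintype κ]
    {p : X → ι} {q : X → κ} (hp : MeasurableSpace.comap p ⊤ ≤ m0)
    (hpq : MeasurableSpace.comap p ⊤ = MeasurableSpace.comap q ⊤) :
    ent μ F p = ent μ F q := by
  have hq : MeasurableSpace.comap q ⊤ ≤ m0 := hpq ▸ hp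
  have h1 := ent_pair μ hF hp hq
  have h2 := ent_pair μ hF hq hp
  rw [ent_zero μ (sup_le hF hq) (hpq.le.trans le_sup_right)] at h1
  rw [ent_zero μ (sup_le hF hp) (hpq.ge.trans le_sup_right), ent_swap] at h2
  linarith

theorem comap_pair {ι κ : Type*} [Finite ι] [Finite κ] (p : X → ι) (q : X → κ) :
    MeasurableSpace.comap (fun x => (p x, q x)) ⊤ =
      MeasurableSpace.comap p ⊤ ⊔ MeasurableSpace.comap q ⊤ := by
  apply le_antisymm
  · rintro s ⟨t, -, rfl⟩
    have : (fun x => (p x, q x)) ⁻¹' t = ⋃ z ∈ t, (p ⁻¹' {z.1} ∩ q ⁻¹' {z.2}) := by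
      ext x; simp
    rw [this]
    refine MeasurableSet.biUnion (to_countable t) fun z _ => MeasurableSet.inter ?_ ?_
    · exact (le_sup_left : MeasurableSpace.comap p ⊤ ≤ _) _ ⟨{z.1}, trivial, rfl⟩
    · exact (le_sup_right : MeasurableSpace.comap q ⊤ ≤ _) _ ⟨{z.2}, trivial, rfl⟩
  · refine sup_le ?_ ?_
    · rintro s ⟨t, -, rfl⟩
      exact ⟨Prod.fst ⁻¹' t, trivial, rfl⟩
    · rintro s ⟨t, -, rfl⟩
      exact ⟨Prod.snd ⁻¹' t, trivial, rfl⟩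

/-- Chain rule in σ-algebra form. -/
theorem ent_chain {m0 : MeasurableSpace X} (μ : Measure X) [IsProbabilityMeasure μ]
    {F : MeasurableSpace X} (hF : F ≤ m0) {ι κ τ : Type*} [Fintype ι] [Fintype κ] [Fintype τ]
    {p : X → ι} {q : X → κ} {r : X → τ} (hr : MeasurableSpace.comap r ⊤ ≤ m0)
    (h : MeasurableSpace.comap r ⊤ = MeasurableSpace.comap p ⊤ ⊔ MeasurableSpace.comap q ⊤) :
    ent μ F r = ent μ F q + ent μ (F ⊔ MeasurableSpace.comap q ⊤) p := by
  rw [← ent_pair μ hF (le_trans (by rw [h]; exact le_sup_left) hr)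
    (le_trans (by rw [h]; exact le_sup_right) hr)]
  exact ent_congr μ hF hr (h.trans (comap_pair p q).symm)

theorem integral_mp {m0 : MeasurableSpace X} (μ : Measure X) {φ : X → X}
    (hφ : MeasurePreserving φ μ μ) {g : X → ℝ} (hg : AEStronglyMeasurable g μ) :
    ∫ x, g (φ x) ∂μ = ∫ y, g y ∂μ := by
  have h := integral_map (μ := μ) hφ.measurable.aemeasurable (f := g) (by rwa [hφ.map_eq])
  rw [← h, hφ.map_eq]

theorem setIntegral_mp {m0 : MeasurableSpace X} (μ : Measure X) {φ : X → X}
    (hφ : MeasurePreserving φ μ μ) {g : X → ℝ} (hg : AEStronglyMeasurable g μ)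
    {t : Set X} (ht : MeasurableSet t) :
    ∫ x in φ ⁻¹' t, g (φ x) ∂μ = ∫ y in t, g y ∂μ := by
  have h := setIntegral_map (μ := μ) ht (f := g) (by rwa [hφ.map_eq])
    hφ.measurable.aemeasurable
  rw [← h, hφ.map_eq]

theorem cPr_shift {F m0 : MeasurableSpace X} (μ : Measure X) [IsProbabilityMeasure μ]
    {φ : X → X} (hφ : MeasurePreserving φ μ μ) (hF : F ≤ m0)
    {A : Set X} (hA : MeasurableSet[m0] A) :
    (fun x => cPr μ F A (φ x)) =ᵐ[μ] cPr μ (MeasurableSpace.comap φ F) (φ ⁻¹' A) := by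
  have hle : MeasurableSpace.comap φ F ≤ m0 :=
    (MeasurableSpace.comap_mono hF).trans hφ.measurable.comap_le
  have hint : Integrable (fun x => cPr μ F A (φ x)) μ :=
    hφ.integrable_comp_of_integrable (g := cPr μ F A) integrable_condExp
  refine ae_eq_condExp_of_forall_setIntegral_eq hle
    (integrable_ind μ (hφ.measurable hA)) (fun s _ _ => hint.integrableOn) ?_ ?_
  · rintro s ⟨t, ht, rfl⟩ _
    have e1 := setIntegral_mp μ hφ (aesm_cPr μ F A) (hF _ ht)
    have e2 := setIntegral_mp μ hφ (integrable_ind μ hA).aestronglyMeasurable (hF _ ht)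
    refine e1.trans (Eq.trans ?_ e2.symm)
    exact setIntegral_condExp hF (integrable_ind μ hA) ht
  · refine StronglyMeasurable.aestronglyMeasurable ?_
    exact (stronglyMeasurable_condExp (m := F)).comp_measurable
      (comap_measurable φ)

theorem ent_shift {F m0 : MeasurableSpace X} (μ : Measure X) [IsProbabilityMeasure μ]
    {φ : X → X} (hφ : MeasurePreserving φ μ μ) (hF : F ≤ m0)
    {ι : Type*} [Fintype ι] {p : X → ι} (hp : MeasurableSpace.comap p ⊤ ≤ m0) :
    ent μ (MeasurableSpace.comap φ F) (p ∘ φ) = ent μ F p := by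
  rw [ent_eq, ent_eq]
  refine Finset.sum_congr rfl fun i _ => ?_
  have hA : MeasurableSet[m0] (p ⁻¹' {i}) := hp _ ⟨{i}, trivial, rfl⟩
  have h := cPr_shift μ hφ hF hA
  have e := integral_mp μ hφ
    (Real.continuous_negMulLog.comp_aestronglyMeasurable (aesm_cPr μ F (p ⁻¹' {i})))
  refine Eq.trans ?_ e
  refine integral_congr_ae ?_
  filter_upwards [h] with x hx
  exact congrArg Real.negMulLog hx.symm

end Chain

open MeasureTheory Filter Topology Set
open scoped symmDiff Classical ENNReal NNReal

section Shift

variable {X : Type*}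

/-- The σ-algebra generated by the translates of `F` with times in `I`. -/
def shAlg (e : Equiv.Perm X) (F : MeasurableSpace X) (I : Set ℤ) : MeasurableSpace X :=
  ⨆ k ∈ I, MeasurableSpace.comap (⇑(e ^ k)) F

theorem shAlg_mono (e : Equiv.Perm X) (F : MeasurableSpace X) {I J : Set ℤ} (h : I ⊆ J) :
    shAlg e F I ≤ shAlg e F J := biSup_mono h

theorem shAlg_mono_left (e : Equiv.Perm X) {F G : MeasurableSpace X} (h : F ≤ G) (I : Set ℤ) :
    shAlg e F I ≤ shAlg e G I :=
  iSup₂_mono fun _ _ => MeasurableSpace.comap_mono h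

theorem le_shAlg (e : Equiv.Perm X) (F : MeasurableSpace X) {I : Set ℤ} {k : ℤ} (h : k ∈ I) :
    MeasurableSpace.comap (⇑(e ^ k)) F ≤ shAlg e F I :=
  le_iSup₂ (f := fun k (_ : k ∈ I) => MeasurableSpace.comap (⇑(e ^ k)) F) k h

theorem shAlg_union (e : Equiv.Perm X) (F : MeasurableSpace X) (I J : Set ℤ) :
    shAlg e F (I ∪ J) = shAlg e F I ⊔ shAlg e F J := iSup_union

theorem shAlg_singleton (e : Equiv.Perm X) (F : MeasurableSpace X) (k : ℤ) :
    shAlg e F {k} = MeasurableSpace.comap (⇑(e ^ k)) F := iSup_singleton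

theorem shAlg_iUnion (e : Equiv.Perm X) (F : MeasurableSpace X) (I : ℕ → Set ℤ) :
    shAlg e F (⋃ n, I n) = ⨆ n, shAlg e F (I n) := iSup_iUnion I _

theorem shAlg_iSup (e : Equiv.Perm X) (F : ℕ → MeasurableSpace X) (I : Set ℤ) :
    shAlg e (⨆ n, F n) I = ⨆ n, shAlg e (F n) I := by
  apply le_antisymm
  · refine iSup₂_le fun k hk => ?_
    rw [MeasurableSpace.comap_iSup]
    exact iSup_mono fun n => le_shAlg e (F n) hk
  · exact iSup_le fun n => shAlg_mono_left e (le_iSup F n) I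

theorem shAlg_shift (e : Equiv.Perm X) (F : MeasurableSpace X) (I : Set ℤ) (j : ℤ) :
    MeasurableSpace.comap (⇑(e ^ j)) (shAlg e F I) = shAlg e F {k | k - j ∈ I} := by
  have key : ∀ k : ℤ, MeasurableSpace.comap (⇑(e ^ j)) (MeasurableSpace.comap (⇑(e ^ k)) F) =
      MeasurableSpace.comap (⇑(e ^ (k + j))) F := by
    intro k
    rw [MeasurableSpace.comap_comp, zpow_add]; rfl
  simp only [shAlg, MeasurableSpace.comap_iSup, key]
  apply le_antisymm
  · refine iSup₂_le fun k hk => ?_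
    exact le_iSup₂ (f := fun k (_ : k ∈ {k | k - j ∈ I}) =>
      MeasurableSpace.comap (⇑(e ^ k)) F) (k + j) (by simpa using hk)
  · refine iSup₂_le fun k hk => ?_
    have := le_iSup₂ (f := fun k (_ : k ∈ I) =>
      MeasurableSpace.comap (⇑(e ^ (k + j))) F) (k - j) hk
    simpa using this

theorem shAlg_le {m0 : MeasurableSpace X} {e : Equiv.Perm X}
    (he : ∀ k : ℤ, Measurable (⇑(e ^ k))) {F : MeasurableSpace X} (hF : F ≤ m0) (I : Set ℤ) :
    shAlg e F I ≤ m0 :=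
  iSup₂_le fun k _ => (MeasurableSpace.comap_mono hF).trans
    (measurable_iff_comap_le.1 (he k))

/-- σ-algebra of a finite-valued map. -/
abbrev sg {ι : Type*} (p : X → ι) : MeasurableSpace X := MeasurableSpace.comap p ⊤

/-- Block of a partition over a finite set of times. -/
def blk (e : Equiv.Perm X) {ι : Type*} (p : X → ι) (I : Finset ℤ) : X → (I → ι) :=
  fun x k => p ((e ^ (k : ℤ)) x)

theorem sg_blk (e : Equiv.Perm X) {ι : Type*} [Finite ι] (p : X → ι) (I : Finset ℤ) :
    sg (blk e p I) = shAlg e (sg p) (I : Set ℤ) := by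
  apply le_antisymm
  · rintro s ⟨t, -, rfl⟩
    have : blk e p I ⁻¹' t = ⋃ z ∈ t, ⋂ k : I, (⇑(e ^ (k : ℤ))) ⁻¹' (p ⁻¹' {z k}) := by
      ext x
      simp only [mem_preimage, mem_iUnion, mem_iInter, mem_singleton_iff, exists_prop]
      constructor
      · intro h; exact ⟨_, h, fun k => rfl⟩
      · rintro ⟨z, hz, h⟩
        have : blk e p I x = z := funext h
        rwa [this]
    rw [this]
    refine MeasurableSet.biUnion (to_countable t) fun z _ => MeasurableSet.iInter fun k => ?_
    exact le_shAlg e (sg p) (I := (I : Set ℤ)) (k := k) k.2 _ ⟨_, ⟨{z k}, trivial, rfl⟩, rfl⟩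
  · refine iSup₂_le fun k hk => ?_
    rintro s ⟨_, ⟨t, -, rfl⟩, rfl⟩
    exact ⟨{z | z ⟨k, hk⟩ ∈ t}, trivial, rfl⟩

theorem sg_comp (e : Equiv.Perm X) {ι : Type*} (p : X → ι) (k : ℤ) :
    sg (p ∘ ⇑(e ^ k)) = MeasurableSpace.comap (⇑(e ^ k)) (sg p) :=
  MeasurableSpace.comap_comp.symm

theorem ent_blk {m0 : MeasurableSpace X} (μ : Measure X) [IsProbabilityMeasure μ]
    {e : Equiv.Perm X} (he : ∀ k : ℤ, MeasurePreserving (⇑(e ^ k)) μ μ)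
    {F : MeasurableSpace X} (hF : F ≤ m0) {ι : Type*} [Fintype ι] {p : X → ι}
    (hp : sg p ≤ m0) (b : ℤ) (n : ℕ) :
    ent μ F (blk e p (Finset.Ico (b - n) b)) =
      ∑ j ∈ Finset.range n,
        ent μ (F ⊔ shAlg e (sg p) (Ico (b - j) b)) (p ∘ ⇑(e ^ (b - 1 - j))) := by
  have hm : ∀ k : ℤ, @Measurable X X m0 m0 (⇑(e ^ k)) := fun k =>
    @MeasurePreserving.measurable X X m0 m0 _ μ μ (he k)
  induction n with
  | zero =>
    rw [Finset.range_zero, Finset.sum_empty]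
    refine ent_zero μ hF ?_
    change sg _ ≤ F
    rw [sg_blk]
    simp [shAlg]
  | succ n ih =>
    rw [Finset.sum_range_succ, ← ih]
    have h1 : sg (blk e p (Finset.Ico (b - (n + 1 : ℕ)) b)) =
        sg (p ∘ ⇑(e ^ (b - 1 - n))) ⊔ sg (blk e p (Finset.Ico (b - n) b)) := by
      rw [sg_blk, sg_blk, sg_comp, ← shAlg_singleton, ← shAlg_union]
      congr 1
      ext k
      simp only [Finset.coe_Ico, mem_Ico, mem_union, mem_singleton_iff]
      push_cast
      omega
    rw [ent_chain μ hF (by rw [← sg, sg_blk]; exact shAlg_le hm hp _) h1]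
    congr 2
    rw [← sg, sg_blk, Finset.coe_Ico]

end Shift

open MeasureTheory Filter Topology Set
open scoped symmDiff Classical ENNReal NNReal

section Formula

variable {X : Type*}

theorem ent_sh {Fq Fp m0 : MeasurableSpace X} (μ : Measure X) [IsProbabilityMeasure μ]
    {e : Equiv.Perm X} (he : ∀ k : ℤ, MeasurePreserving (⇑(e ^ k)) μ μ)
    (hq : Fq ≤ m0) (hFp : Fp ≤ m0) {ι : Type*} [Fintype ι] {p : X → ι}
    (hp : sg p ≤ m0) (I J I' J' : Set ℤ) (j : ℤ) (hI : I' = {k | k - j ∈ I})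
    (hJ : J' = {k | k - j ∈ J}) :
    ent μ (shAlg e Fq I' ⊔ shAlg e Fp J') (p ∘ ⇑(e ^ j)) =
      ent μ (shAlg e Fq I ⊔ shAlg e Fp J) p := by
  have hm : ∀ k : ℤ, Measurable (⇑(e ^ k)) := fun k => (he k).measurable
  rw [hI, hJ, ← shAlg_shift, ← shAlg_shift, ← MeasurableSpace.comap_sup]
  exact ent_shift μ (he j) (sup_le (shAlg_le hm hq _) (shAlg_le hm hFp _)) hp

/-- Squeeze for two-parameter averages. -/
theorem cesaro_two {d : ℕ → ℕ → ℝ} {L : ℝ} (hd : ∀ s t, L ≤ d s t)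
    (hanti : ∀ s t s' t', s ≤ s' → t ≤ t' → d s' t' ≤ d s t)
    (hlim : Tendsto (fun m => d m m) atTop (𝓝 L)) :
    Tendsto (fun n : ℕ => (n : ℝ)⁻¹ * ∑ j ∈ Finset.range n, d (n - 1 - j) j) atTop (𝓝 L) := by
  have h1 := hlim.cesaro
  have h2 : Tendsto (fun n : ℕ => 2 * ((n : ℝ)⁻¹ * ∑ j ∈ Finset.range n, d j j) - L) atTop
      (𝓝 L) := by
    have := (h1.const_mul 2).sub_const L
    convert this using 2
    ring
  refine tendsto_of_tendsto_of_tendsto_of_le_of_le' tendsto_const_nhds h2 ?_ ?_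
  · filter_upwards [eventually_gt_atTop 0] with n hn
    have hn' : (0 : ℝ) < n := by exact_mod_cast hn
    have : (n : ℝ) * L ≤ ∑ j ∈ Finset.range n, d (n - 1 - j) j := by
      have := Finset.card_nsmul_le_sum (Finset.range n) (fun j => d (n - 1 - j) j) L
        (fun j _ => hd _ _)
      simpa using this
    calc L = (n : ℝ)⁻¹ * (n * L) := by field_simp
      _ ≤ _ := by gcongr
  · filter_upwards [eventually_gt_atTop 0] with n hn
    have hn' : (0 : ℝ) < n := by exact_mod_cast hn
    have hb : ∀ s t, d s t ≤ d s s + d t t - L := by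
      intro s t
      rcases le_total s t with h | h
      · have := hanti s s s t le_rfl h
        linarith [hd t t]
      · have := hanti t t s t h le_rfl
        linarith [hd s s]
    have : ∑ j ∈ Finset.range n, d (n - 1 - j) j ≤
        2 * ∑ j ∈ Finset.range n, d j j - n * L := by
      calc _ ≤ ∑ j ∈ Finset.range n, (d (n - 1 - j) (n - 1 - j) + d j j - L) :=
            Finset.sum_le_sum fun j _ => hb _ _
        _ = _ := by
          rw [Finset.sum_sub_distrib, Finset.sum_add_distrib,
            Finset.sum_range_reflect (fun j => d j j) n]
          simp
          ring
    calc _ ≤ (n : ℝ)⁻¹ * (2 * ∑ j ∈ Finset.range n, d j j - n * L) := by gcongr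
      _ = _ := by field_simp

theorem ico_nat_union (c : ℤ) : (⋃ n : ℕ, Ico c (c + n)) = Ici c := by
  ext k
  simp only [mem_iUnion, mem_Ico, mem_Ici]
  constructor
  · rintro ⟨n, h, -⟩; exact h
  · intro h; exact ⟨(k - c).toNat + 1, h, by push_cast; omega⟩

theorem shAlg_ici (e : Equiv.Perm X) (F : MeasurableSpace X) (c : ℤ) :
    shAlg e F (Ici c) = ⨆ n : ℕ, shAlg e F (Ico c (c + n)) := by
  rw [← shAlg_iUnion, ico_nat_union]

theorem shAlg_univ (e : Equiv.Perm X) (F : MeasurableSpace X) :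
    shAlg e F univ = ⨆ n : ℕ, shAlg e F (Ico (-n : ℤ) (1 + n)) := by
  rw [← shAlg_iUnion]
  congr 1
  ext k
  simp only [mem_iUnion, mem_Ico, mem_univ, true_iff]
  exact ⟨k.natAbs, by omega, by omega⟩

theorem joint_tendsto {m0 : MeasurableSpace X} (μ : Measure X) [IsProbabilityMeasure μ]
    {e : Equiv.Perm X} (he : ∀ k : ℤ, MeasurePreserving (⇑(e ^ k)) μ μ)
    {ι κ : Type*} [Fintype ι] [Fintype κ] {p : X → ι} {q : X → κ}
    (hp : sg p ≤ m0) (hq : sg q ≤ m0) :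
    Tendsto (fun n : ℕ => (n : ℝ)⁻¹ * ent μ ⊥ (fun x =>
      (blk e p (Finset.Ico ((n : ℤ) - n) n) x, blk e q (Finset.Ico ((n : ℤ) - n) n) x))) atTop
      (𝓝 (ent μ (shAlg e (sg q) (Ici 1)) q +
        ent μ (shAlg e (sg q) univ ⊔ shAlg e (sg p) (Ici 1)) p)) := by
  have hm : ∀ k : ℤ, @Measurable X X m0 m0 (⇑(e ^ k)) := fun k =>
    @MeasurePreserving.measurable X X m0 m0 _ μ μ (he k)
  have hb : (⊥ : MeasurableSpace X) ≤ m0 := bot_le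
  have e1 : ∀ n : ℕ, ent μ ⊥ (fun x =>
      (blk e p (Finset.Ico ((n : ℤ) - n) n) x, blk e q (Finset.Ico ((n : ℤ) - n) n) x)) =
      ∑ j ∈ Finset.range n, ent μ (shAlg e (sg q) (Ico 1 (1 + j))) q +
      ∑ j ∈ Finset.range n, ent μ (shAlg e (sg q) (Ico (-(n - 1 - j : ℕ)) (1 + j)) ⊔
        shAlg e (sg p) (Ico 1 (1 + j))) p := by
    intro n
    rw [ent_pair μ hb (by rw [← sg, sg_blk]; exact shAlg_le hm hp _)
      (by rw [← sg, sg_blk]; exact shAlg_le hm hq _), ent_blk μ he hb hq,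
      ent_blk μ he (sup_le hb (by rw [← sg, sg_blk]; exact shAlg_le hm hq _)) hp]
    congr 1
    · refine Finset.sum_congr rfl fun j hj => ?_
      rw [Finset.mem_range] at hj
      have := ent_sh μ he hb hq hq ∅ (Ico 1 (1 + j)) ∅ (Ico (n - j : ℤ) n) (n - 1 - j)
        (by simp) (by ext k; simp only [mem_Ico, mem_setOf_eq]; omega)
      simpa [shAlg] using this
    · refine Finset.sum_congr rfl fun j hj => ?_
      rw [Finset.mem_range] at hj
      rw [← sg, sg_blk, bot_sup_eq, Finset.coe_Ico]
      exact ent_sh μ he hq hp hp _ _ _ _ (n - 1 - j)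
        (by ext k; simp only [mem_Ico, mem_setOf_eq]; omega)
        (by ext k; simp only [mem_Ico, mem_setOf_eq]; omega)
  simp only [e1, mul_add]
  refine Tendsto.add ?_ ?_
  · have : Tendsto (fun j : ℕ => ent μ (shAlg e (sg q) (Ico 1 (1 + j))) q) atTop
        (𝓝 (ent μ (shAlg e (sg q) (Ici 1)) q)) := by
      rw [shAlg_ici]
      refine ent_tendsto μ ?_ (fun n => shAlg_le hm hq _) hq
      intro a b hab
      exact shAlg_mono e _ (Ico_subset_Ico_right (by simpa using hab))
    exact this.cesaro
  · refine cesaro_two (d := fun s t : ℕ => ent μ (shAlg e (sg q) (Ico (-(s : ℤ)) (1 + t)) ⊔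
        shAlg e (sg p) (Ico 1 (1 + t))) p) ?_ ?_ ?_
    · intro s t
      refine ent_anti μ (sup_le_sup (shAlg_mono e _ (subset_univ _))
        (shAlg_mono e _ Ico_subset_Ici_self))
        (sup_le (shAlg_le hm hq _) (shAlg_le hm hp _)) hp
    · intro s t s' t' hs ht
      refine ent_anti μ (sup_le_sup (shAlg_mono e _ (Ico_subset_Ico (by omega) (by omega)))
        (shAlg_mono e _ (Ico_subset_Ico (by omega) (by omega))))
        (sup_le (shAlg_le hm hq _) (shAlg_le hm hp _)) hp
    · rw [shAlg_ici, shAlg_univ, ← iSup_sup_eq]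
      refine ent_tendsto μ ?_ (fun n => sup_le (shAlg_le hm hq _) (shAlg_le hm hp _)) hp
      intro a b hab
      exact (sup_le_sup (shAlg_mono e _ (Ico_subset_Ico (by omega) (by omega)))
        (shAlg_mono e _ (Ico_subset_Ico (by omega) (by omega))))

theorem pinsker_formula {m0 : MeasurableSpace X} (μ : Measure X) [IsProbabilityMeasure μ]
    {e : Equiv.Perm X} (he : ∀ k : ℤ, MeasurePreserving (⇑(e ^ k)) μ μ)
    {ι κ : Type*} [Fintype ι] [Fintype κ] {p : X → ι} {q : X → κ}
    (hp : sg p ≤ m0) (hq : sg q ≤ m0) :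
    ent μ (shAlg e (sg q) (Ici 1)) q +
        ent μ (shAlg e (sg q) univ ⊔ shAlg e (sg p) (Ici 1)) p =
    ent μ (shAlg e (sg p) (Ici 1)) p +
        ent μ (shAlg e (sg p) univ ⊔ shAlg e (sg q) (Ici 1)) q := by
  refine tendsto_nhds_unique (joint_tendsto μ he hp hq) ?_
  refine (joint_tendsto μ he hq hp).congr fun n => ?_
  rw [ent_swap]

end Formula

open MeasureTheory Filter Topology Set
open scoped symmDiff Classical ENNReal NNReal

section Directions

variable {X : Type*}

theorem zero_entropy_of_tail {m0 : MeasurableSpace X} (μ : Measure X) [IsProbabilityMeasure μ]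
    {e : Equiv.Perm X} (he : ∀ k : ℤ, MeasurePreserving (⇑(e ^ k)) μ μ)
    {P : MeasurableSpace X} (hP : P ≤ m0)
    (hgen : ∀ A, MeasurableSet[m0] A → ∃ B, MeasurableSet[shAlg e P univ] B ∧ A =ᵐ[μ] B)
    {m : ℕ → ℕ} {Q : ∀ n : ℕ, X → Fin (m n)}
    (hmono : Monotone fun n => sg (Q n)) (hsup : ⨆ n, sg (Q n) = P)
    (hlim : Tendsto (fun n => ent μ (shAlg e (sg (Q n)) (Ici 1)) (Q n) -
      ent μ (shAlg e P (Ici 1)) (Q n)) atTop (𝓝 0))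
    {κ : Type*} [Fintype κ] {q : X → κ} (hq : sg q ≤ m0)
    (hqT : shAlg e (sg q) univ ≤ shAlg e P (Ici 1)) :
    ent μ (shAlg e (sg q) (Ici 1)) q = 0 := by
  have hm : ∀ k : ℤ, @Measurable X X m0 m0 (⇑(e ^ k)) := fun k =>
    @MeasurePreserving.measurable X X m0 m0 _ μ μ (he k)
  have hQP : ∀ n, sg (Q n) ≤ P := fun n => by
    rw [← hsup]; exact le_iSup (fun n => sg (Q n)) n
  have hQ : ∀ n, sg (Q n) ≤ m0 := fun n => (hQP n).trans hP
  have h0 : ent μ (shAlg e P univ) q = 0 :=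
    ent_zero_ae μ (shAlg_le hm hP _) fun i => hgen _ (hq _ ⟨{i}, trivial, rfl⟩)
  have h1 : Tendsto (fun n => ent μ (shAlg e (sg (Q n)) univ) q) atTop (𝓝 0) := by
    rw [← h0, ← hsup, shAlg_iSup]
    exact ent_tendsto μ (fun a b hab => shAlg_mono_left e (hmono hab) _)
      (fun n => shAlg_le hm (hQ n) _) hq
  refine le_antisymm ?_ (ent_nonneg μ (shAlg_le hm hq _) hq)
  have h2 := hlim.add h1
  rw [add_zero] at h2
  refine ge_of_tendsto' h2 fun n => ?_
  have h3 := pinsker_formula μ he (hQ n) hq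
  have h4 : ent μ (shAlg e P (Ici 1)) (Q n) ≤
      ent μ (shAlg e (sg q) univ ⊔ shAlg e (sg (Q n)) (Ici 1)) (Q n) :=
    ent_anti μ (sup_le hqT (shAlg_mono_left e (hQP n) _)) (shAlg_le hm hP _) (hQ n)
  have h5 : ent μ (shAlg e (sg (Q n)) univ ⊔ shAlg e (sg q) (Ici 1)) q ≤
      ent μ (shAlg e (sg (Q n)) univ) q :=
    ent_anti μ le_sup_left (sup_le (shAlg_le hm (hQ n) _) (shAlg_le hm hq _)) hq
  linarith

theorem cPr_eq_of_sg {m0 : MeasurableSpace X} (μ : Measure X) [IsProbabilityMeasure μ]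
    {F G : MeasurableSpace X} (hFG : F ≤ G) (hG : G ≤ m0) {ι : Type*} [Fintype ι] {p : X → ι}
    (hp : sg p ≤ m0) (h : ent μ F p ≤ ent μ G p) {A : Set X} (hA : MeasurableSet[sg p] A) :
    cPr μ G A =ᵐ[μ] cPr μ F A := by
  obtain ⟨t, -, rfl⟩ := hA
  have h1 : (p ⁻¹' t).indicator (fun _ => (1 : ℝ)) =
      ∑ i ∈ t.toFinset, (p ⁻¹' {i}).indicator (fun _ => (1 : ℝ)) := by
    ext x
    simp [Finset.sum_apply, indicator_apply]
  have h2 : ∀ H : MeasurableSpace X, cPr μ H (p ⁻¹' t) =ᵐ[μ]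
      ∑ i ∈ t.toFinset, cPr μ H (p ⁻¹' {i}) := by
    intro H
    rw [cPr, h1]
    exact condExp_finsetSum (fun i _ => integrable_ind μ (hp _ ⟨{i}, trivial, rfl⟩)) H
  refine (h2 G).trans (EventuallyEq.trans ?_ (h2 F).symm)
  have h3 : ∀ᵐ x ∂μ, ∀ i, cPr μ G (p ⁻¹' {i}) x = cPr μ F (p ⁻¹' {i}) x :=
    ae_all_iff.2 fun i => cPr_eq_of_ent_eq μ hFG hG hp h i
  filter_upwards [h3] with x hx
  simp [Finset.sum_apply, hx]

theorem ent_block_le {m0 : MeasurableSpace X} (μ : Measure X) [IsProbabilityMeasure μ]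
    {e : Equiv.Perm X} (he : ∀ k : ℤ, MeasurePreserving (⇑(e ^ k)) μ μ)
    {ι κ : Type*} [Fintype ι] [Fintype κ] {p : X → ι} {q : X → κ}
    (hp : sg p ≤ m0) (hq : sg q ≤ m0) (h0 : ent μ (shAlg e (sg q) (Ici 1)) q = 0)
    (b : ℤ) (N : ℕ) :
    ent μ (shAlg e (sg p) (Ici b)) (blk e p (Finset.Ico (b - N) b)) ≤
      ent μ (shAlg e (sg q) univ ⊔ shAlg e (sg p) (Ici b))
        (blk e p (Finset.Ico (b - N) b)) := by
  have hm : ∀ k : ℤ, @Measurable X X m0 m0 (⇑(e ^ k)) := fun k =>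
    @MeasurePreserving.measurable X X m0 m0 _ μ μ (he k)
  rw [ent_blk μ he (shAlg_le hm hp _) hp,
    ent_blk μ he (sup_le (shAlg_le hm hq _) (shAlg_le hm hp _)) hp]
  refine Finset.sum_le_sum fun j _ => ?_
  rw [sup_assoc, ← shAlg_union]
  have hU : Ici b ∪ Ico (b - j) b = {k : ℤ | k - (b - 1 - j) ∈ Ici 1} := by
    ext k
    simp only [mem_union, mem_Ici, mem_Ico, mem_ofPred_eq]
    omega
  have h1 := ent_sh μ he hq hp hp univ (Ici 1) univ _ (b - 1 - j) (by simp) hU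
  have h2 := ent_sh μ he hq hp hp ∅ (Ici 1) ∅ _ (b - 1 - j) (by simp) hU
  have hbot : shAlg e (sg q) ∅ = ⊥ := by simp [shAlg]
  rw [hbot, bot_sup_eq, bot_sup_eq] at h2
  rw [h1, h2]
  have h3 := pinsker_formula μ he hp hq
  have h4 : 0 ≤ ent μ (shAlg e (sg p) univ ⊔ shAlg e (sg q) (Ici 1)) q :=
    ent_nonneg μ (sup_le (shAlg_le hm hp _) (shAlg_le hm hq _)) hq
  linarith

theorem block_integral {m0 : MeasurableSpace X} (μ : Measure X) [IsProbabilityMeasure μ]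
    {G G' : MeasurableSpace X} (hGG : G ≤ G') (hG' : G' ≤ m0) {A C E : Set X}
    (hA : MeasurableSet[m0] A) (hC : MeasurableSet[G] C) (hE : MeasurableSet[G'] E)
    (h : cPr μ G' A =ᵐ[μ] cPr μ G A) :
    ∫ x in A ∩ C, (E.indicator (fun _ => (1 : ℝ)) x - cPr μ G E x) ∂μ = 0 := by
  have hG := hGG.trans hG'
  have hEm := hG' _ hE
  have hCm := hG _ hC
  have hone : ∀ S : Set X, ∀ᵐ x ∂μ, ‖S.indicator (fun _ => (1 : ℝ)) x‖ ≤ 1 := fun S =>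
    Eventually.of_forall fun x => by by_cases hx : x ∈ S <;> simp [hx]
  have hcb : ∀ S, MeasurableSet[m0] S →
      ∀ᵐ x ∂μ, ‖C.indicator (cPr μ G S) x‖ ≤ 1 := by
    intro S hS
    filter_upwards [cPr_mem μ hG hS] with x hx
    by_cases hxC : x ∈ C
    · simpa [hxC, abs_of_nonneg hx.1] using hx.2
    · simp [hxC]
  have hsm : ∀ S, StronglyMeasurable[G] (C.indicator (cPr μ G S)) := fun S =>
    StronglyMeasurable.indicator stronglyMeasurable_condExp hC
  have hEC : StronglyMeasurable[G'] ((E ∩ C).indicator (fun _ => (1 : ℝ))) :=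
    StronglyMeasurable.indicator stronglyMeasurable_const
      (@MeasurableSet.inter _ G' _ _ hE (hGG _ hC))
  have t1 := test_cPr μ hG' hA hEC (hone _)
  have t2 := test_cPr μ hG hEm (hsm A) (hcb A hA)
  have t3 := test_cPr μ hG hA (hsm E) (hcb E hEm)
  have i1 : Integrable (E.indicator (fun _ => (1 : ℝ))) μ := integrable_ind μ hEm
  have i2 : Integrable (cPr μ G E) μ := integrable_condExp
  rw [integral_sub i1.integrableOn i2.integrableOn, sub_eq_zero]
  rw [← integral_indicator (hA.inter hCm), ← integral_indicator (hA.inter hCm)]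
  calc ∫ x, (A ∩ C).indicator (E.indicator (fun _ => (1 : ℝ))) x ∂μ
      = ∫ x, (E ∩ C).indicator (fun _ => (1 : ℝ)) x * A.indicator (fun _ => (1 : ℝ)) x ∂μ := by
        congr 1; ext x
        by_cases hxA : x ∈ A <;> by_cases hxC : x ∈ C <;> by_cases hxE : x ∈ E <;>
          simp [hxA, hxC, hxE]
    _ = ∫ x, (E ∩ C).indicator (fun _ => (1 : ℝ)) x * cPr μ G' A x ∂μ := t1
    _ = ∫ x, C.indicator (cPr μ G A) x * E.indicator (fun _ => (1 : ℝ)) x ∂μ := by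
        refine integral_congr_ae ?_
        filter_upwards [h] with x hx
        rw [hx]
        by_cases hxC : x ∈ C <;> by_cases hxE : x ∈ E <;> simp [hxC, hxE]
    _ = ∫ x, C.indicator (cPr μ G A) x * cPr μ G E x ∂μ := t2
    _ = ∫ x, C.indicator (cPr μ G E) x * cPr μ G A x ∂μ := by
        congr 1; ext x
        by_cases hxC : x ∈ C <;> simp [hxC, mul_comm]
    _ = ∫ x, C.indicator (cPr μ G E) x * A.indicator (fun _ => (1 : ℝ)) x ∂μ := t3.symm
    _ = _ := by
        congr 1; ext x
        by_cases hxA : x ∈ A <;> by_cases hxC : x ∈ C <;> simp [hxA, hxC]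

theorem pi_lambda_zero {m0 : MeasurableSpace X} (μ : Measure X) [IsProbabilityMeasure μ]
    {f : X → ℝ} (hf : Integrable f μ) {S : Set (Set X)} (hS : IsPiSystem S)
    (huniv : univ ∈ S) (hSm : ∀ s ∈ S, MeasurableSet[m0] s)
    (h0 : ∀ s ∈ S, ∫ x in s, f x ∂μ = 0)
    (hgen : ∀ A, MeasurableSet[m0] A →
      ∃ B, MeasurableSet[MeasurableSpace.generateFrom S] B ∧ A =ᵐ[μ] B) :
    f =ᵐ[μ] 0 := by
  have hle : MeasurableSpace.generateFrom S ≤ m0 := MeasurableSpace.generateFrom_le hSm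
  have htot : ∫ x, f x ∂μ = 0 := by simpa using h0 _ huniv
  have key : ∀ B, MeasurableSet[MeasurableSpace.generateFrom S] B → ∫ x in B, f x ∂μ = 0 := by
    intro B hB
    induction B, hB using MeasurableSpace.induction_on_inter rfl hS with
    | empty => simp
    | basic t ht => exact h0 t ht
    | compl t ht ih =>
      have := integral_add_compl (hle _ ht) hf
      linarith
    | iUnion g hd hg ih =>
      rw [integral_iUnion (fun i => hle _ (hg i)) hd hf.integrableOn]
      simp [ih]
  refine hf.ae_eq_zero_of_forall_setIntegral_eq_zero fun A hA _ => ?_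
  obtain ⟨B, hB, hAB⟩ := hgen A hA
  rw [setIntegral_congr_set hAB, key B hB]

theorem mem_of_zero_entropy {m0 : MeasurableSpace X} (μ : Measure X) [IsProbabilityMeasure μ]
    {e : Equiv.Perm X} (he : ∀ k : ℤ, MeasurePreserving (⇑(e ^ k)) μ μ)
    {P : MeasurableSpace X} (hP : P ≤ m0)
    (hgen : ∀ A, MeasurableSet[m0] A → ∃ B, MeasurableSet[shAlg e P univ] B ∧ A =ᵐ[μ] B)
    {m : ℕ → ℕ} {Q : ∀ n : ℕ, X → Fin (m n)}
    (hmono : Monotone fun n => sg (Q n)) (hsup : ⨆ n, sg (Q n) = P)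
    {κ : Type*} [Fintype κ] {q : X → κ} (hq : sg q ≤ m0)
    (h0 : ent μ (shAlg e (sg q) (Ici 1)) q = 0) {E : Set X} (hE : MeasurableSet[sg q] E)
    (b : ℤ) : ∃ B, MeasurableSet[shAlg e P (Ici b)] B ∧ E =ᵐ[μ] B := by
  have hm : ∀ k : ℤ, @Measurable X X m0 m0 (⇑(e ^ k)) := fun k =>
    @MeasurePreserving.measurable X X m0 m0 _ μ μ (he k)
  have hQP : ∀ n, sg (Q n) ≤ P := fun n => by
    rw [← hsup]; exact le_iSup (fun n => sg (Q n)) n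
  have hQ : ∀ n, sg (Q n) ≤ m0 := fun n => (hQP n).trans hP
  set G := shAlg e P (Ici b) with hGdef
  set G' := shAlg e (sg q) univ ⊔ G with hG'def
  have hG : G ≤ m0 := shAlg_le hm hP _
  have hG' : G' ≤ m0 := sup_le (shAlg_le hm hq _) hG
  have hGG : G ≤ G' := le_sup_right
  have hE' : MeasurableSet[G'] E := by
    have : sg q ≤ G' := by
      refine le_trans ?_ (le_sup_left : _ ≤ G')
      have := le_shAlg e (sg q) (mem_univ (0 : ℤ))
      simpa using this
    exact this _ hE
  have hEm := hG' _ hE'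
  let W : ℕ → MeasurableSpace X := fun N => shAlg e (sg (Q N)) (Ico (b - N) b)
  have hW : ∀ N, W N ≤ m0 := fun N => shAlg_le hm (hQ N) _
  have hWmono : Monotone W := fun a c hac =>
    (shAlg_mono_left e (hmono hac) _).trans (shAlg_mono e _ (Ico_subset_Ico_left (by omega)))
  have hblock : ∀ N A, MeasurableSet[W N] A → cPr μ G' A =ᵐ[μ] cPr μ G A := by
    intro N A hA
    have l1 := cPr_tendsto μ (F := fun n => shAlg e (sg (Q n)) (Ici b))
      (fun a c hac => shAlg_mono_left e (hmono hac) _) (fun n => shAlg_le hm (hQ n) _) A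
    have l2 := cPr_tendsto μ (F := fun n => shAlg e (sg q) univ ⊔ shAlg e (sg (Q n)) (Ici b))
      (fun a c hac => sup_le_sup_left (shAlg_mono_left e (hmono hac) _) _)
      (fun n => sup_le (shAlg_le hm hq _) (shAlg_le hm (hQ n) _)) A
    rw [← shAlg_iSup, hsup] at l1
    rw [← sup_iSup, ← shAlg_iSup, hsup] at l2
    have l3 : ∀ᵐ x ∂μ, ∀ n, N ≤ n →
        cPr μ (shAlg e (sg q) univ ⊔ shAlg e (sg (Q n)) (Ici b)) A x =
          cPr μ (shAlg e (sg (Q n)) (Ici b)) A x := by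
      rw [ae_all_iff]
      intro n
      by_cases hn : N ≤ n
      · have hA' : MeasurableSet[sg (blk e (Q n) (Finset.Ico (b - N) b))] A := by
          rw [sg_blk, Finset.coe_Ico]
          exact shAlg_mono_left e (hmono hn) _ _ hA
        have := cPr_eq_of_sg μ le_sup_right
          (sup_le (shAlg_le hm hq _) (shAlg_le hm (hQ n) _))
          (by rw [sg_blk]; exact shAlg_le hm (hQ n) _)
          (ent_block_le μ he (hQ n) hq h0 b N) hA'
        filter_upwards [this] with x hx _ using hx
      · exact Eventually.of_forall fun x h => absurd h hn
    filter_upwards [l1, l2, l3] with x h1 h2 h3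
    refine tendsto_nhds_unique h2 (h1.congr' ?_)
    filter_upwards [eventually_ge_atTop N] with n hn using (h3 n hn).symm
  let S : Set (Set X) := {s | ∃ N A C, MeasurableSet[W N] A ∧ MeasurableSet[G] C ∧ s = A ∩ C}
  have hWS : ∀ N, W N ≤ MeasurableSpace.generateFrom S := fun N A hA =>
    MeasurableSpace.measurableSet_generateFrom
      ⟨N, A, univ, hA, @MeasurableSet.univ _ G, (inter_univ A).symm⟩
  have hGS : G ≤ MeasurableSpace.generateFrom S := fun C hC =>
    MeasurableSpace.measurableSet_generateFrom
      ⟨0, univ, C, @MeasurableSet.univ _ (W 0), hC, (univ_inter C).symm⟩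
  have hhull : shAlg e P univ ≤ MeasurableSpace.generateFrom S := by
    refine iSup₂_le fun k _ => ?_
    by_cases hk : b ≤ k
    · exact (le_shAlg e P (I := Ici b) hk).trans hGS
    · rw [← hsup, MeasurableSpace.comap_iSup]
      refine iSup_le fun n => ?_
      refine le_trans ?_ (hWS (max n (b - k).toNat))
      refine (MeasurableSpace.comap_mono (hmono (le_max_left n (b - k).toNat))).trans ?_
      refine le_shAlg e _ ?_
      simp only [mem_Ico]
      omega
  have hf : (fun x => E.indicator (fun _ => (1 : ℝ)) x - cPr μ G E x) =ᵐ[μ] 0 := by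
    refine pi_lambda_zero μ ((integrable_ind μ hEm).sub integrable_condExp) (S := S) ?_ ?_ ?_ ?_ ?_
    · rintro _ ⟨N, A, C, hA, hC, rfl⟩ _ ⟨N', A', C', hA', hC', rfl⟩ -
      refine ⟨max N N', A ∩ A', C ∩ C', ?_, ?_, inter_inter_inter_comm _ _ _ _⟩
      · exact @MeasurableSet.inter _ (W (max N N')) _ _ (hWmono (le_max_left _ _) _ hA)
          (hWmono (le_max_right _ _) _ hA')
      · exact @MeasurableSet.inter _ G _ _ hC hC'
    · exact ⟨0, univ, univ, @MeasurableSet.univ _ (W 0), @MeasurableSet.univ _ G, by simp⟩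
    · rintro _ ⟨N, A, C, hA, hC, rfl⟩
      exact @MeasurableSet.inter _ m0 _ _ (hW N _ hA) (hG _ hC)
    · rintro _ ⟨N, A, C, hA, hC, rfl⟩
      exact block_integral μ hGG hG' (hW N _ hA) hC hE' (hblock N A hA)
    · intro A hA
      obtain ⟨B, hB, hAB⟩ := hgen A hA
      exact ⟨B, hhull _ hB, hAB⟩
  have hsm : StronglyMeasurable[G] (cPr μ G E) := stronglyMeasurable_condExp
  refine ⟨cPr μ G E ⁻¹' {1}, hsm.measurable (measurableSet_singleton 1), ?_⟩
  filter_upwards [hf] with x hx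
  have hx' : E.indicator (fun _ => (1 : ℝ)) x = cPr μ G E x := sub_eq_zero.1 hx
  refine propext ?_
  change x ∈ E ↔ cPr μ G E x = 1
  rw [← hx']
  by_cases hxE : x ∈ E <;> simp [hxE]

theorem tail_of_all {m0 : MeasurableSpace X} (μ : Measure X) {G : ℕ → MeasurableSpace X}
    (hG : Antitone G) {E : Set X} (h : ∀ n, ∃ B, MeasurableSet[G n] B ∧ E =ᵐ[μ] B) :
    ∃ B, MeasurableSet[⨅ n, G n] B ∧ E =ᵐ[μ] B := by
  choose B hB hEB using h
  refine ⟨limsup B atTop, ?_, ?_⟩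
  · rw [MeasurableSpace.measurableSet_iInf]
    intro n
    rw [← limsup_nat_add B n]
    exact @MeasurableSet.measurableSet_limsup X (G n) (fun k => B (k + n))
      (fun k => hG (Nat.le_add_left n k) _ (hB _))
  · have : ∀ᵐ x ∂μ, ∀ n, x ∈ E ↔ x ∈ B n := ae_all_iff.2 fun n => (hEB n).mem_iff
    filter_upwards [this] with x hx
    refine propext ?_
    change x ∈ E ↔ x ∈ limsup B atTop
    rw [mem_limsup_iff_frequently_mem]
    simp [← hx]

end Directions

open MeasureTheory Filter Topology Set
open scoped symmDiff Classical ENNReal NNReal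

section Final

variable {X : Type*}

theorem iter_eq (e : Equiv.Perm X) (n : ℕ) : (⇑e)^[n] = ⇑(e ^ (n : ℤ)) := by
  rw [zpow_natCast, Equiv.Perm.coe_pow]

theorem symm_iter_eq (e : Equiv.Perm X) (n : ℕ) : (⇑e.symm)^[n] = ⇑(e ^ (-(n : ℤ))) := by
  rw [zpow_neg, zpow_natCast, ← inv_pow, Equiv.Perm.coe_pow]
  rfl

theorem pastAlg_eq (e : Equiv.Perm X) (F : MeasurableSpace X) :
    pastAlg (⇑e) F = shAlg e F (Ici 1) := by
  apply le_antisymm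
  · refine iSup_le fun n => ?_
    rw [iter_eq]
    exact le_shAlg e F (by simp)
  · refine iSup₂_le fun k hk => ?_
    rw [mem_Ici] at hk
    have h : k = (((k - 1).toNat + 1 : ℕ) : ℤ) := by omega
    rw [h, ← iter_eq]
    exact le_iSup (fun n : ℕ => MeasurableSpace.comap ((⇑e)^[n + 1]) F) _

theorem partPast_eq (e : Equiv.Perm X) {ι : Type*} (p : X → ι) :
    partPast (⇑e) p = shAlg e (sg p) (Ici 1) := by
  rw [← pastAlg_eq]
  refine iSup_congr fun n => ?_
  rw [sg, MeasurableSpace.comap_comp]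
  rfl

theorem hullAlg_eq (e : Equiv.Perm X) (F : MeasurableSpace X) :
    hullAlg (⇑e) (⇑e.symm) F = shAlg e F univ := by
  apply le_antisymm
  · refine iSup_le fun n => ?_
    rw [iter_eq, symm_iter_eq]
    exact sup_le (le_shAlg e F (mem_univ _)) (le_shAlg e F (mem_univ _))
  · refine iSup₂_le fun k _ => ?_
    refine le_trans ?_ (le_iSup (fun n : ℕ => MeasurableSpace.comap ((⇑e)^[n]) F ⊔
      MeasurableSpace.comap ((⇑e.symm)^[n]) F) k.natAbs)
    rw [iter_eq, symm_iter_eq]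
    rcases Int.natAbs_eq k with h | h
    · rw [← h]; exact le_sup_left
    · rw [← h]; exact le_sup_right

theorem tail_eq (e : Equiv.Perm X) (F : MeasurableSpace X) (k : ℕ) :
    MeasurableSpace.comap ((⇑e)^[k + 1]) (pastAlg (⇑e) F) = shAlg e F (Ici (k + 2)) := by
  rw [pastAlg_eq, iter_eq, shAlg_shift]
  congr 1
  ext j
  simp only [mem_ofPred_eq, mem_Ici]
  push_cast
  omega

theorem zpow_mp {m0 : MeasurableSpace X} {μ : Measure X} (T : X ≃ᵐ X)
    (hT : MeasurePreserving (⇑T) μ μ) (k : ℤ) :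
    MeasurePreserving (⇑((T.toEquiv : Equiv.Perm X) ^ k)) μ μ := by
  rcases Int.natAbs_eq k with h | h
  · rw [h, ← iter_eq]
    exact hT.iterate _
  · rw [h, ← symm_iter_eq]
    exact (hT.symm T).iterate _

theorem main_aux {P m0 : MeasurableSpace X} (μ : Measure X) [IsProbabilityMeasure μ]
    (e : Equiv.Perm X) (he : ∀ k : ℤ, MeasurePreserving (⇑(e ^ k)) μ μ)
    (hP : @IsExcellentPartition X P m0 μ (⇑e) (⇑e.symm)) :
    @SubModNull X m0 μ (⨅ k : ℕ, MeasurableSpace.comap ((⇑e)^[k + 1]) (pastAlg (⇑e) P))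
      (@pinskerAlg X m0 μ (⇑e)) ∧
    @SubModNull X m0 μ (@pinskerAlg X m0 μ (⇑e))
      (⨅ k : ℕ, MeasurableSpace.comap ((⇑e)^[k + 1]) (pastAlg (⇑e) P)) := by
  have hm : ∀ k : ℤ, @Measurable X X m0 m0 (⇑(e ^ k)) := fun k => (he k).measurable
  obtain ⟨hPm, hull, m, Q, -, hmono, hsup, hlim⟩ := hP
  have hgen : ∀ A, MeasurableSet[m0] A →
      ∃ B, MeasurableSet[shAlg e P univ] B ∧ A =ᵐ[μ] B := by
    intro A hA
    obtain ⟨B, hB, hAB⟩ := hull A hA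
    rw [hullAlg_eq] at hB
    exact ⟨B, hB, measure_symmDiff_eq_zero_iff.1 hAB⟩
  have hlim' : Tendsto (fun n => ent μ (shAlg e (sg (Q n)) (Ici 1)) (Q n) -
      ent μ (shAlg e P (Ici 1)) (Q n)) atTop (𝓝 0) := by
    simp only [partPast_eq, pastAlg_eq] at hlim
    exact hlim
  simp only [tail_eq]
  constructor
  · intro A hA
    rw [MeasurableSpace.measurableSet_iInf] at hA
    refine ⟨A, ?_, by simp⟩
    have hAm : MeasurableSet[m0] A := shAlg_le hm hPm _ _ (hA 0)
    set q : X → Fin 2 := fun x => if x ∈ A then 0 else 1 with hqdef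
    have hqA : q ⁻¹' {0} = A := by
      ext x
      by_cases hx : x ∈ A <;> simp [hqdef, hx]
    have hsg : ∀ F : MeasurableSpace X, MeasurableSet[F] A → sg q ≤ F := by
      intro F hF
      rintro _ ⟨t, -, rfl⟩
      have : q ⁻¹' t = (if (0 : Fin 2) ∈ t then A else ∅) ∪ (if (1 : Fin 2) ∈ t then Aᶜ else ∅) := by
        ext x
        by_cases hx : x ∈ A <;> by_cases h0 : (0 : Fin 2) ∈ t <;>
          by_cases h1 : (1 : Fin 2) ∈ t <;> simp [hqdef, hx, h0, h1]
      rw [this]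
      refine @MeasurableSet.union _ F _ _ ?_ ?_
      · split_ifs
        · exact hF
        · exact @MeasurableSet.empty _ F
      · split_ifs
        · exact @MeasurableSet.compl _ _ F hF
        · exact @MeasurableSet.empty _ F
    have hz := zero_entropy_of_tail μ he hPm hgen hmono hsup hlim' (hsg m0 hAm) (by
      refine iSup₂_le fun k _ => ?_
      refine (MeasurableSpace.comap_mono (hsg _ (hA k.natAbs))).trans ?_
      rw [shAlg_shift]
      refine shAlg_mono e P fun j hj => ?_
      simp only [mem_ofPred_eq, mem_Ici] at hj ⊢
      omega)
    have hz' : @partKS X m0 μ (⇑e) _ _ q = 0 := by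
      rw [partKS, partPast_eq]
      exact hz
    have hle : sg q ≤ @pinskerAlg X m0 μ (⇑e) :=
      le_iSup_of_le 2 <| le_iSup_of_le q <|
        le_iSup_of_le (measurable_iff_comap_le.2 (by
          refine le_trans (MeasurableSpace.comap_mono le_top) (hsg m0 hAm))) <|
        le_iSup_of_le hz' le_rfl
    exact hle _ ⟨{0}, trivial, hqA⟩
  · have hle : @pinskerAlg X m0 μ (⇑e) ≤
        eventuallyMeasurableSpace (⨅ k : ℕ, shAlg e P (Ici (k + 2))) (ae μ) := by
      refine iSup_le fun k => iSup_le fun q => iSup_le fun hq => iSup_le fun hz => ?_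
      intro E hE
      rw [partKS, partPast_eq] at hz
      have hq' : sg q ≤ m0 := hq.comap_le
      exact tail_of_all μ (G := fun k : ℕ => shAlg e P (Ici (k + 2)))
        (fun a c hac => shAlg_mono e P (Ici_subset_Ici.2 (by omega)))
        fun n => mem_of_zero_entropy μ he hPm hgen hmono hsup hq' hz hE _
    intro A hA
    obtain ⟨B, hB, hAB⟩ := hle A hA
    exact ⟨B, hB, measure_symmDiff_eq_zero_iff.2 hAB⟩

end Final

/-- For an excellent measurable partition `P` of an invertible
measure-preserving system on a Lebesgue (standard Borel) probability space, the tail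
σ-algebra `⋂_{k ≥ 1} T^{-k} σ(P⁻)` equals the Pinsker σ-algebra `Π_μ` mod `μ`. -/
theorem excellent_tail_eq_pinsker
    {X : Type*} (P : MeasurableSpace X) [m0 : MeasurableSpace X] [StandardBorelSpace X]
    (μ : Measure X) [IsProbabilityMeasure μ]
    (T : X ≃ᵐ X) (hT : MeasurePreserving (⇑T) μ μ)
    (hP : IsExcellentPartition P μ (⇑T) (⇑T.symm)) :
    SubModNull μ (⨅ k : ℕ, MeasurableSpace.comap ((⇑T)^[k + 1]) (pastAlg (⇑T) P))
      (pinskerAlg μ (⇑T)) ∧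
    SubModNull μ (pinskerAlg μ (⇑T))
      (⨅ k : ℕ, MeasurableSpace.comap ((⇑T)^[k + 1]) (pastAlg (⇑T) P)) := by
  exact main_aux μ T.toEquiv (zpow_mp T hT) hP
end

section
/- Let (X,T) be an invertible topological dynamical system with Borel σ-algebra B, and let μ be a T-ergodic Borel probability measure. (i) There exists an excellent measurable partition P of (X,B,T,μ) such that any pair of points belonging to the same atom of P^- is asymptotic. (ii) Moreover, if h_μ(X,T) > 0, then for any such partition the σ-algebras σ(P^-) and B do not coincide up to sets of μ-measure 0. -/
open MeasureTheory Filter Topology Set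
open scoped symmDiff Classical ENNReal NNReal

set_option linter.unusedSectionVars false
set_option linter.unusedVariables false

section Helpers

namespace AsymAux

abbrev sg {X ι : Type*} (p : X → ι) : MeasurableSpace X := MeasurableSpace.comap p ⊤

lemma sg_fiber {X ι : Type*} (p : X → ι) (i : ι) : MeasurableSet[sg p] (p ⁻¹' {i}) :=
  ⟨{i}, trivial, rfl⟩

/-- conditional probability -/
noncomputable abbrev ce {X : Type*} [MeasurableSpace X] (μ : Measure X) (F : MeasurableSpace X)
    (A : Set X) : X → ℝ := μ[A.indicator (fun _ => (1 : ℝ)) | F]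

variable {X : Type*} {F G m0 : MeasurableSpace X} {μ : Measure X} [IsProbabilityMeasure μ]

lemma int_ind {A : Set X} (hA : MeasurableSet A) :
    Integrable (A.indicator (fun _ => (1 : ℝ))) μ :=
  (integrable_const (1 : ℝ)).indicator hA

lemma ce_mem (hF : F ≤ m0) {A : Set X} (hA : MeasurableSet A) :
    ∀ᵐ x ∂μ, 0 ≤ ce μ F A x ∧ ce μ F A x ≤ 1 := by
  have h0 : 0 ≤ᵐ[μ] ce μ F A := condExp_nonneg (Eventually.of_forall fun x => by
    by_cases h : x ∈ A <;> simp [h])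
  have h1 : ce μ F A ≤ᵐ[μ] μ[(fun _ => (1 : ℝ)) | F] :=
    condExp_mono (int_ind hA) (integrable_const _) (Eventually.of_forall fun x => by
      by_cases h : x ∈ A <;> simp [h])
  rw [condExp_const hF] at h1
  filter_upwards [h0, h1] with x a b using ⟨a, b⟩

lemma nml_bd {t : ℝ} (h : 0 ≤ t ∧ t ≤ 1) : ‖Real.negMulLog t‖ ≤ 1 := by
  rw [Real.norm_eq_abs, abs_of_nonneg (Real.negMulLog_nonneg h.1 h.2)]
  linarith [Real.negMulLog_le_one_sub_self h.1]

lemma int_nml {f : X → ℝ} (hf : AEStronglyMeasurable f μ) (h : ∀ᵐ x ∂μ, 0 ≤ f x ∧ f x ≤ 1) :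
    Integrable (fun x => Real.negMulLog (f x)) μ := by
  refine Integrable.of_bound (Real.continuous_negMulLog.comp_aestronglyMeasurable hf) 1 ?_
  filter_upwards [h] with x hx using nml_bd hx

lemma ce_asm (hF : F ≤ m0) (A : Set X) : AEStronglyMeasurable (ce μ F A) μ :=
  (stronglyMeasurable_condExp.mono hF).aestronglyMeasurable

lemma int_nml_ce (hF : F ≤ m0) {A : Set X} (hA : MeasurableSet A) :
    Integrable (fun x => Real.negMulLog (ce μ F A x)) μ :=
  int_nml (ce_asm hF A) (ce_mem hF hA)

variable {ι κ : Type*} [Fintype ι] [Fintype κ]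

lemma H_nonneg (hF : F ≤ m0) {p : X → ι} (hp : sg p ≤ m0) : 0 ≤ condPartEntropy μ F p := by
  refine Finset.sum_nonneg fun i _ => integral_nonneg_of_ae ?_
  filter_upwards [ce_mem hF (hp _ (sg_fiber p i))] with x hx
  exact Real.negMulLog_nonneg hx.1 hx.2

lemma H_zero (hF : F ≤ m0) {p : X → ι}
    (h : ∀ i, ∃ B, MeasurableSet[F] B ∧ μ ((p ⁻¹' {i}) ∆ B) = 0) :
    condPartEntropy μ F p = 0 := by
  refine Finset.sum_eq_zero fun i _ => ?_
  obtain ⟨B, hB, h0⟩ := h i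
  have hae : (p ⁻¹' {i}).indicator (fun _ => (1 : ℝ)) =ᵐ[μ] B.indicator (fun _ => (1 : ℝ)) :=
    indicator_ae_eq_of_ae_eq_set (measure_symmDiff_eq_zero_iff.1 h0)
  have h2 : μ[B.indicator (fun _ => (1 : ℝ)) | F] = B.indicator (fun _ => (1 : ℝ)) :=
    condExp_of_stronglyMeasurable hF (stronglyMeasurable_const.indicator hB) (int_ind (hF _ hB))
  have h3 := condExp_congr_ae (m := F) hae
  rw [h2] at h3
  rw [integral_eq_zero_of_ae]
  filter_upwards [h3] with x hx
  rw [hx]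
  by_cases hxB : x ∈ B <;> simp [hxB]

lemma H_zero_of_le (hF : F ≤ m0) {p : X → ι} (h : sg p ≤ F) : condPartEntropy μ F p = 0 :=
  H_zero hF fun i => ⟨_, h _ (sg_fiber p i), by simp⟩

lemma H_anti (hF : F ≤ m0) (hG : G ≤ m0) (hFG : F ≤ G) {p : X → ι} (hp : sg p ≤ m0) :
    condPartEntropy μ G p ≤ condPartEntropy μ F p := by
  refine Finset.sum_le_sum fun i _ => ?_
  have hA := hp _ (sg_fiber p i)
  set A := p ⁻¹' {i}
  have hJ := Real.concaveOn_negMulLog.condExp_map_le (μ := μ) (f := ce μ G A) hF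
    (Real.continuous_negMulLog.upperSemicontinuous.upperSemicontinuousOn _)
    (by filter_upwards [ce_mem hG hA] with x hx using hx.1) isClosed_Ici integrable_condExp
    (int_nml_ce hG hA)
  have hT : μ[ce μ G A | F] =ᵐ[μ] ce μ F A := condExp_condExp_of_le hFG hG
  calc ∫ x, Real.negMulLog (ce μ G A x) ∂μ
      = ∫ x, (μ[Real.negMulLog ∘ ce μ G A | F]) x ∂μ := (integral_condExp hF).symm
    _ ≤ ∫ x, Real.negMulLog (ce μ F A x) ∂μ := by
        refine integral_mono_ae integrable_condExp (int_nml_ce hF hA) ?_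
        filter_upwards [hJ, hT] with x h1 h2
        rw [← h2]; exact h1

lemma H_tendsto {F : ℕ → MeasurableSpace X} {m0 : MeasurableSpace X} {μ : Measure X}
    [IsProbabilityMeasure μ] (hF : ∀ n, F n ≤ m0) (hmono : Monotone F)
    {p : X → ι} (hp : sg p ≤ m0) :
    Tendsto (fun n => condPartEntropy μ (F n) p) atTop (𝓝 (condPartEntropy μ (⨆ n, F n) p)) := by
  refine tendsto_finsetSum _ fun i _ => ?_
  have hA := hp _ (sg_fiber p i)
  set A := p ⁻¹' {i}
  let ℱ : Filtration ℕ m0 := ⟨F, hmono, hF⟩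
  refine tendsto_integral_of_dominated_convergence (fun _ => (1 : ℝ)) (fun n => ?_)
    (integrable_const _) (fun n => ?_) ?_
  · exact (int_nml_ce (hF n) hA).aestronglyMeasurable
  · filter_upwards [ce_mem (hF n) hA] with x hx using nml_bd hx
  · filter_upwards [tendsto_ae_condExp (μ := μ) (ℱ := ℱ) (A.indicator (fun _ => (1 : ℝ)))]
      with x hx
    exact (Real.continuous_negMulLog.tendsto _).comp hx

lemma mp_integral {Y : Type*} {m0 : MeasurableSpace Y} {μ ν : Measure Y} {T : Y → Y}
    (hT : MeasurePreserving T μ ν)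
    {f : Y → ℝ} (hf : AEStronglyMeasurable f ν) : ∫ x, f (T x) ∂μ = ∫ x, f x ∂ν := by
  rw [← hT.map_eq, integral_map hT.aemeasurable (by rwa [hT.map_eq])]

lemma ce_comap (hF : F ≤ m0) {T : X → X} (hT : MeasurePreserving T μ μ) {A : Set X}
    (hA : MeasurableSet A) : ce μ (F.comap T) (T ⁻¹' A) =ᵐ[μ] fun x => ce μ F A (T x) := by
  have hle : F.comap T ≤ m0 := (MeasurableSpace.comap_mono hF).trans hT.measurable.comap_le
  have hi : Integrable (fun x => ce μ F A (T x)) μ :=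
    hT.integrable_comp_of_integrable integrable_condExp
  refine (ae_eq_condExp_of_forall_setIntegral_eq hle (int_ind (hT.measurable hA))
    (fun s _ _ => hi.integrableOn) ?_ ?_).symm
  · rintro s ⟨C, hC, rfl⟩ -
    have hC' := hF _ hC
    have e : ∀ f : X → ℝ, Integrable f μ →
        ∫ x in T ⁻¹' C, f (T x) ∂μ = ∫ x in C, f x ∂μ := by
      intro f hf
      have := hT.restrict_preimage hC'
      exact mp_integral this hf.aestronglyMeasurable.restrict
    rw [e _ integrable_condExp, setIntegral_condExp hF (int_ind hA) hC, ← e _ (int_ind hA)]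
    rfl
  · have : StronglyMeasurable[F.comap T] (fun x => ce μ F A (T x)) :=
      (stronglyMeasurable_condExp (m := F)).comp_measurable (comap_measurable T)
    exact this.aestronglyMeasurable

lemma H_shift (hF : F ≤ m0) {T : X → X} (hT : MeasurePreserving T μ μ) {p : X → ι}
    (hp : sg p ≤ m0) :
    condPartEntropy μ (F.comap T) (fun x => p (T x)) = condPartEntropy μ F p := by
  refine Finset.sum_congr rfl fun i _ => ?_
  have hA := hp _ (sg_fiber p i)
  have h := ce_comap (μ := μ) hF hT hA
  have hi := int_nml_ce (μ := μ) hF hA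
  rw [integral_congr_ae (g := fun x => Real.negMulLog (ce μ F (p ⁻¹' {i}) (T x)))]
  · exact mp_integral (f := fun x => Real.negMulLog (ce μ F (p ⁻¹' {i}) x)) hT
      hi.aestronglyMeasurable
  · filter_upwards [h] with x hx
    rw [← hx]; rfl

lemma trace_exists {p : X → ι} (i : ι) {S : Set X}
    (hS : MeasurableSet[F ⊔ sg p] S) :
    ∃ C, MeasurableSet[F] C ∧ S ∩ p ⁻¹' {i} = C ∩ p ⁻¹' {i} := by
  let M : MeasurableSpace X :=
    { MeasurableSet' := fun S => ∃ C, MeasurableSet[F] C ∧ S ∩ p ⁻¹' {i} = C ∩ p ⁻¹' {i}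
      measurableSet_empty := ⟨∅, MeasurableSet.empty, rfl⟩
      measurableSet_compl := by
        rintro S ⟨C, hC, h⟩
        refine ⟨Cᶜ, hC.compl, ?_⟩
        ext x
        have := congrArg (x ∈ ·) h
        simp only [mem_inter_iff, eq_iff_iff, mem_compl_iff] at this ⊢
        tauto
      measurableSet_iUnion := by
        intro f hf
        choose C hC h using hf
        refine ⟨⋃ n, C n, MeasurableSet.iUnion hC, ?_⟩
        rw [iUnion_inter, iUnion_inter]
        exact iUnion_congr h }
  have : F ⊔ sg p ≤ M := by
    refine sup_le (fun s hs => ⟨s, hs, rfl⟩) ?_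
    rintro s ⟨t, -, rfl⟩
    by_cases hi : i ∈ t
    · refine ⟨univ, @MeasurableSet.univ X F, ?_⟩
      ext x; simp only [mem_inter_iff, mem_preimage, mem_singleton_iff, mem_univ, true_and]
      exact ⟨fun h => h.2, fun h => ⟨h ▸ hi, h⟩⟩
    · refine ⟨∅, @MeasurableSet.empty X F, ?_⟩
      ext x; simp only [mem_inter_iff, mem_preimage, mem_singleton_iff, mem_empty_iff_false,
        false_and, iff_false]
      rintro ⟨h1, h2⟩
      exact hi (h2 ▸ h1)
  exact this S hS

/-- integrating against an indicator = integrating against the conditional probability -/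
lemma integral_ind_mul (hF : F ≤ m0) {A : Set X} (hA : MeasurableSet A) {w : X → ℝ}
    (hw : StronglyMeasurable[F] w) {c : ℝ} (hb : ∀ᵐ x ∂μ, ‖w x‖ ≤ c) :
    ∫ x, A.indicator w x ∂μ = ∫ x, ce μ F A x * w x ∂μ := by
  have h := condExp_stronglyMeasurable_mul_of_bound (μ := μ) hF hw (int_ind hA) c hb
  have h1 : (A.indicator w) = w * A.indicator (fun _ => (1 : ℝ)) := by
    ext x; by_cases hx : x ∈ A <;> simp [hx]
  rw [h1, ← integral_condExp hF]
  refine integral_congr_ae ?_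
  filter_upwards [h] with x hx
  rw [hx, Pi.mul_apply, mul_comm]

lemma ce_le (hF : F ≤ m0) {A B : Set X} (hA : MeasurableSet A) (hB : MeasurableSet B)
    (hAB : A ⊆ B) : ∀ᵐ x ∂μ, ce μ F A x ≤ ce μ F B x :=
  condExp_mono (int_ind hA) (int_ind hB) (Eventually.of_forall fun x =>
    indicator_le_indicator_of_subset hAB (fun _ => zero_le_one) x)

lemma div_mem (hF : F ≤ m0) {A B : Set X} (hA : MeasurableSet A) (hB : MeasurableSet B)
    (hAB : A ⊆ B) : ∀ᵐ x ∂μ, 0 ≤ ce μ F A x / ce μ F B x ∧ ce μ F A x / ce μ F B x ≤ 1 := by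
  filter_upwards [ce_mem hF hA, ce_mem hF hB, ce_le hF hA hB hAB] with x h1 h2 h3
  exact ⟨div_nonneg h1.1 h2.1, div_le_one_of_le₀ h3 h2.1⟩

lemma div_sm (A B : Set X) : StronglyMeasurable[F] (fun x => ce μ F A x / ce μ F B x) :=
  StronglyMeasurable.div stronglyMeasurable_condExp stronglyMeasurable_condExp

lemma norm_of_mem {f : X → ℝ} (h : ∀ᵐ x ∂μ, 0 ≤ f x ∧ f x ≤ 1) : ∀ᵐ x ∂μ, ‖f x‖ ≤ 1 := by
  filter_upwards [h] with x hx
  rw [Real.norm_eq_abs, abs_of_nonneg hx.1]; exact hx.2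

lemma ce_join (hF : F ≤ m0) {p : X → ι} (hp : sg p ≤ m0) (i : ι) {B : Set X}
    (hB : MeasurableSet B) :
    (p ⁻¹' {i}).indicator (ce μ (F ⊔ sg p) B) =ᵐ[μ]
      (p ⁻¹' {i}).indicator (fun x => ce μ F (p ⁻¹' {i} ∩ B) x / ce μ F (p ⁻¹' {i}) x) := by
  have hG : F ⊔ sg p ≤ m0 := sup_le hF hp
  have hA := hp _ (sg_fiber p i)
  have hAG : MeasurableSet[F ⊔ sg p] (p ⁻¹' {i}) := (le_sup_right : sg p ≤ F ⊔ sg p) _ (sg_fiber p i)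
  generalize hAdef : p ⁻¹' {i} = A at *
  have h1 : μ[A.indicator (B.indicator (fun _ => (1 : ℝ))) | F ⊔ sg p] =ᵐ[μ]
      A.indicator (ce μ (F ⊔ sg p) B) := condExp_indicator (int_ind hB) hAG
  refine h1.symm.trans ?_
  have hdm := div_mem (μ := μ) hF (hA.inter hB) hA inter_subset_left
  have hsm := div_sm (μ := μ) (F := F) (A ∩ B) A
  have hInt : Integrable (A.indicator
      (fun x => ce μ F (A ∩ B) x / ce μ F A x)) μ :=
    (Integrable.of_bound (hsm.mono hF).aestronglyMeasurable 1 (norm_of_mem hdm)).indicator hA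
  refine (ae_eq_condExp_of_forall_setIntegral_eq hG ((int_ind hB).indicator hA)
    (fun s _ _ => hInt.integrableOn) ?_ ?_).symm
  · intro S hS _
    obtain ⟨C, hC, hSC⟩ := trace_exists (F := F) (p := p) i hS
    rw [hAdef] at hSC
    have e : ∀ f : X → ℝ, ∫ x in S, A.indicator f x ∂μ = ∫ x in C, A.indicator f x ∂μ := by
      intro f
      rw [setIntegral_indicator hA, setIntegral_indicator hA, hSC]
    rw [e, e, ← integral_indicator (hF _ hC), ← integral_indicator (hF _ hC),
      indicator_indicator, indicator_indicator, inter_comm C A,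
      ← indicator_indicator, ← indicator_indicator]
    rw [integral_ind_mul hF hA (hsm.indicator hC) (c := 1) ?_]
    · rw [indicator_indicator, inter_comm A C, ← indicator_indicator, integral_indicator (hF _ hC),
        indicator_indicator, ← setIntegral_condExp hF (int_ind (hA.inter hB)) hC,
        ← integral_indicator (hF _ hC)]
      refine integral_congr_ae ?_
      filter_upwards [ce_mem hF (hA.inter hB), ce_mem hF hA,
        ce_le hF (hA.inter hB) hA inter_subset_left] with x h1 h2 h3
      by_cases hx : x ∈ C
      · simp only [hx, indicator_of_mem]
        by_cases hz : ce μ F A x = 0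
        · have : ce μ F (A ∩ B) x = 0 := le_antisymm (hz ▸ h3) h1.1
          simp only [hz, zero_mul]; exact this.symm
        · exact mul_div_cancel₀ _ hz
      · simp [hx]
    · filter_upwards [norm_of_mem hdm] with x hx
      by_cases hxC : x ∈ C
      · simpa only [hxC, indicator_of_mem] using hx
      · simp [hxC]
  · exact ((hsm.mono (le_sup_left : F ≤ F ⊔ sg p)).indicator hAG).aestronglyMeasurable

lemma sum_ind_fiber {p : X → ι} (f : X → ℝ) (x : X) :
    ∑ i, (p ⁻¹' {i}).indicator f x = f x := by
  rw [Finset.sum_eq_single (p x)]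
  · simp
  · intro b _ hb
    rw [indicator_of_notMem]
    simpa using hb.symm
  · simp

lemma ce_sum (hF : F ≤ m0) {A : Set X} (hA : MeasurableSet A) {q : X → κ} (hq : sg q ≤ m0) :
    ∀ᵐ x ∂μ, ∑ j, ce μ F (A ∩ q ⁻¹' {j}) x = ce μ F A x := by
  have h := condExp_finsetSum (μ := μ) (s := (Finset.univ : Finset κ))
    (f := fun j => (A ∩ q ⁻¹' {j}).indicator (fun _ => (1 : ℝ)))
    (fun j _ => int_ind (hA.inter (hq _ (sg_fiber q j)))) F
  have e : ∑ j, (A ∩ q ⁻¹' {j}).indicator (fun _ => (1 : ℝ)) = A.indicator (fun _ => (1 : ℝ)) := by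
    ext x
    rw [Finset.sum_apply]
    simp_rw [inter_comm A, ← indicator_indicator]
    exact sum_ind_fiber _ x
  rw [e] at h
  filter_upwards [h] with x hx
  have h3 : ce μ F A x = _ := hx
  rw [h3, Finset.sum_apply]

lemma nml_sum {f : ℝ} {g : κ → ℝ} (hg : ∀ j, 0 ≤ g j) (hs : ∑ j, g j = f) :
    ∑ j, f * Real.negMulLog (g j / f) = ∑ j, Real.negMulLog (g j) - Real.negMulLog f := by
  by_cases hf : f = 0
  · subst hf
    have : ∀ j, g j = 0 := fun j => (Finset.sum_eq_zero_iff_of_nonneg (fun j _ => hg j)).1 hs j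
      (Finset.mem_univ j)
    simp [this]
  · have : ∀ j, f * Real.negMulLog (g j / f) =
        Real.negMulLog (g j) - g j / f * Real.negMulLog f := by
      intro j
      have := Real.negMulLog_mul f (g j / f)
      rw [mul_div_cancel₀ _ hf] at this
      linarith
    simp_rw [this]
    rw [Finset.sum_sub_distrib, ← Finset.sum_mul, ← Finset.sum_div, hs, div_self hf, one_mul]

/-- chain rule -/
lemma H_chain (hF : F ≤ m0) {p : X → ι} (hp : sg p ≤ m0) {q : X → κ} (hq : sg q ≤ m0) :
    condPartEntropy μ F (fun x => (p x, q x)) =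
      condPartEntropy μ F p + condPartEntropy μ (F ⊔ sg p) q := by
  have hG : F ⊔ sg p ≤ m0 := sup_le hF hp
  have hA : ∀ i, MeasurableSet (p ⁻¹' {i}) := fun i => hp _ (sg_fiber p i)
  have hB : ∀ j, MeasurableSet (q ⁻¹' {j}) := fun j => hq _ (sg_fiber q j)
  have e1 : condPartEntropy μ F (fun x => (p x, q x)) =
      ∑ i, ∑ j, ∫ x, Real.negMulLog (ce μ F (p ⁻¹' {i} ∩ q ⁻¹' {j}) x) ∂μ := by
    unfold condPartEntropy
    rw [Fintype.sum_prod_type]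
    refine Finset.sum_congr rfl fun i _ => Finset.sum_congr rfl fun j _ => ?_
    have : (fun x => (p x, q x)) ⁻¹' {(i, j)} = p ⁻¹' {i} ∩ q ⁻¹' {j} := by
      ext x; simp
    rw [this]
  have hdm : ∀ i j, ∀ᵐ x ∂μ, 0 ≤ ce μ F (p ⁻¹' {i} ∩ q ⁻¹' {j}) x / ce μ F (p ⁻¹' {i}) x ∧
      ce μ F (p ⁻¹' {i} ∩ q ⁻¹' {j}) x / ce μ F (p ⁻¹' {i}) x ≤ 1 := fun i j =>
    div_mem hF ((hA i).inter (hB j)) (hA i) inter_subset_left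
  have hInt : ∀ i j, Integrable (fun x => ce μ F (p ⁻¹' {i}) x *
        Real.negMulLog (ce μ F (p ⁻¹' {i} ∩ q ⁻¹' {j}) x / ce μ F (p ⁻¹' {i}) x)) μ := by
    intro i j
    refine Integrable.of_bound ((ce_asm hF _).mul (int_nml
      ((div_sm (F := F) _ _).mono hF).aestronglyMeasurable (hdm i j)).aestronglyMeasurable) 1 ?_
    filter_upwards [hdm i j, norm_of_mem (ce_mem (μ := μ) hF (hA i))] with x h1 h2
    rw [norm_mul]
    exact mul_le_one₀ h2 (norm_nonneg _) (nml_bd h1)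
  have e2 : ∀ j, ∫ x, Real.negMulLog (ce μ (F ⊔ sg p) (q ⁻¹' {j}) x) ∂μ =
      ∑ i, ∫ x, ce μ F (p ⁻¹' {i}) x *
        Real.negMulLog (ce μ F (p ⁻¹' {i} ∩ q ⁻¹' {j}) x / ce μ F (p ⁻¹' {i}) x) ∂μ := by
    intro j
    have hi := int_nml_ce (μ := μ) hG (hB j)
    calc _ = ∫ x, ∑ i, (p ⁻¹' {i}).indicator
              (fun x => Real.negMulLog (ce μ (F ⊔ sg p) (q ⁻¹' {j}) x)) x ∂μ := by
            simp_rw [sum_ind_fiber]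
      _ = ∑ i, ∫ x, (p ⁻¹' {i}).indicator
              (fun x => Real.negMulLog (ce μ (F ⊔ sg p) (q ⁻¹' {j}) x)) x ∂μ :=
            integral_finsetSum _ fun i _ => hi.indicator (hA i)
      _ = _ := by
            refine Finset.sum_congr rfl fun i _ => ?_
            rw [← integral_ind_mul hF (hA i) (c := 1)
              (Real.continuous_negMulLog.comp_stronglyMeasurable (div_sm (F := F) _ _))
              (by filter_upwards [hdm i j] with x hx using nml_bd hx)]
            refine integral_congr_ae ?_
            filter_upwards [ce_join hF hp i (hB j)] with x hx
            by_cases hxi : x ∈ p ⁻¹' {i}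
            · simp only [hxi, indicator_of_mem] at hx ⊢
              rw [hx]
            · simp [hxi]
  have e3 : condPartEntropy μ (F ⊔ sg p) q = ∑ i, ∑ j, ∫ x, ce μ F (p ⁻¹' {i}) x *
        Real.negMulLog (ce μ F (p ⁻¹' {i} ∩ q ⁻¹' {j}) x / ce μ F (p ⁻¹' {i}) x) ∂μ := by
    rw [Finset.sum_comm]
    exact Finset.sum_congr rfl fun j _ => e2 j
  rw [e1, e3, condPartEntropy, ← Finset.sum_add_distrib]
  refine Finset.sum_congr rfl fun i _ => ?_
  rw [← integral_finsetSum _ fun j _ => hInt i j,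
    ← integral_finsetSum _ fun j _ => int_nml_ce hF ((hA i).inter (hB j)),
    ← integral_add (int_nml_ce hF (hA i)) (integrable_finsetSum _ fun j _ => hInt i j)]
  refine integral_congr_ae ?_
  have hall : ∀ᵐ x ∂μ, ∀ j, 0 ≤ ce μ F (p ⁻¹' {i} ∩ q ⁻¹' {j}) x ∧
      ce μ F (p ⁻¹' {i} ∩ q ⁻¹' {j}) x ≤ 1 :=
    ae_all_iff.2 fun j => ce_mem hF ((hA i).inter (hB j))
  filter_upwards [hall, ce_sum (μ := μ) hF (hA i) hq] with x h1 h2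
  have := nml_sum (fun j => (h1 j).1) h2
  simp only [this]
  ring

lemma sg_prod (p : X → ι) (q : X → κ) : sg (fun x => (p x, q x)) = sg p ⊔ sg q := by
  let : MeasurableSpace ι := ⊤
  let : MeasurableSpace κ := ⊤
  have h : (⊤ : MeasurableSpace (ι × κ)) = (⊤ : MeasurableSpace ι).prod (⊤ : MeasurableSpace κ) := by
    refine (eq_top_iff.2 fun s _ => ?_).symm
    exact (MeasurableSet.of_discrete : MeasurableSet s)
  unfold sg
  rw [h]
  exact MeasurableSpace.comap_prodMk p q

lemma sg_comp_le {p : X → ι} (hp : sg p ≤ m0) {T : X → X} (hT : Measurable T) :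
    sg (fun x => p (T x)) ≤ m0 := by
  rw [show sg (fun x => p (T x)) = (sg p).comap T from MeasurableSpace.comap_comp.symm]
  exact (MeasurableSpace.comap_mono hp).trans hT.comap_le

lemma H_swap (p : X → ι) (q : X → κ) :
    condPartEntropy μ F (fun x => (p x, q x)) = condPartEntropy μ F (fun x => (q x, p x)) := by
  refine Fintype.sum_equiv (Equiv.prodComm ι κ) _ _ fun ij => ?_
  have : (fun x => (p x, q x)) ⁻¹' {ij} = (fun x => (q x, p x)) ⁻¹' {Equiv.prodComm ι κ ij} := by
    ext x; obtain ⟨i, j⟩ := ij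
    simp [and_comm]
  rw [this]

lemma H_chain_comm (hF : F ≤ m0) {p : X → ι} (hp : sg p ≤ m0) {q : X → κ} (hq : sg q ≤ m0) :
    condPartEntropy μ F p + condPartEntropy μ (F ⊔ sg p) q =
      condPartEntropy μ F q + condPartEntropy μ (F ⊔ sg q) p := by
  rw [← H_chain hF hp hq, ← H_chain hF hq hp, H_swap]

lemma H_split (hF : F ≤ m0) {p : X → ι} (hp : sg p ≤ m0) {q : X → κ} (hq : sg q ≤ m0)
    (hpq : sg p ≤ sg q) :
    condPartEntropy μ F q = condPartEntropy μ F p + condPartEntropy μ (F ⊔ sg p) q := by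
  rw [H_chain_comm hF hp hq, H_zero_of_le (F := F ⊔ sg q) (sup_le hF hq) (hpq.trans le_sup_right),
    add_zero]

lemma H_absorb (hF : F ≤ m0) {p : X → ι} (hp : sg p ≤ m0) {q : X → κ} (hq : sg q ≤ m0)
    (hpq : sg p ≤ sg q) :
    condPartEntropy μ F (fun x => (p x, q x)) = condPartEntropy μ F q := by
  rw [H_chain hF hp hq, H_split hF hp hq hpq]

lemma H_diff (hF : F ≤ m0) (hG : G ≤ m0) (hFG : F ≤ G) {p : X → ι} (hp : sg p ≤ m0) {q : X → κ}
    (hq : sg q ≤ m0) (hpq : sg p ≤ sg q) :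
    condPartEntropy μ F p - condPartEntropy μ G p ≤
      condPartEntropy μ F q - condPartEntropy μ G q := by
  rw [H_split hF hp hq hpq, H_split hG hp hq hpq]
  have := H_anti (μ := μ) (sup_le hF hp) (sup_le hG hp) (sup_le_sup_right hFG (sg p)) hq
  linarith

/-- the tail of a partition -/
def tl {X ι : Type*} (T : X → X) (p : X → ι) (k : ℕ) : MeasurableSpace X :=
  ⨆ n : ℕ, sg (fun x => p (T^[n + k] x))

lemma tl_le {T : X → X} (hT : Measurable T) {p : X → ι} (hp : sg p ≤ m0) (k : ℕ) :
    tl T p k ≤ m0 := iSup_le fun n => sg_comp_le hp (hT.iterate _)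

lemma tl_succ_sup (T : X → X) (p : X → ι) (k : ℕ) :
    tl T p (k + 1) ⊔ sg (fun x => p (T^[k] x)) = tl T p k := by
  unfold tl
  rw [← sup_iSup_nat_succ (fun n => sg (fun x => p (T^[n + k] x))), sup_comm]
  congr 1
  · simp
  · refine iSup_congr fun n => ?_
    rw [show n + (k + 1) = n + 1 + k by ring]

lemma tl_anti (T : X → X) (p : X → ι) : Antitone (tl T p) :=
  antitone_nat_of_succ_le fun k => by rw [← tl_succ_sup T p k]; exact le_sup_left

lemma tl_comap (T : X → X) (p : X → ι) (k : ℕ) : (tl T p k).comap T = tl T p (k + 1) := by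
  unfold tl
  rw [MeasurableSpace.comap_iSup]
  refine iSup_congr fun n => ?_
  exact MeasurableSpace.comap_comp

lemma sg_le_tl (T : X → X) (p : X → ι) {k n : ℕ} (h : k ≤ n) :
    sg (fun x => p (T^[n] x)) ≤ tl T p k := by
  obtain ⟨m, rfl⟩ := Nat.exists_eq_add_of_le' h
  exact le_iSup (fun n => sg (fun x => p (T^[n + k] x))) m

lemma tl_prod (T : X → X) (p : X → ι) (q : X → κ) (k : ℕ) :
    tl T (fun x => (p x, q x)) k = tl T p k ⊔ tl T q k := by
  unfold tl
  rw [← iSup_sup_eq]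
  exact iSup_congr fun n => sg_prod (fun x => p (T^[n + k] x)) (fun x => q (T^[n + k] x))

lemma partKS_eq (T : X → X) (p : X → ι) : partKS μ T p = condPartEntropy μ (tl T p 1) p := rfl

noncomputable def aa (μ : Measure X) (T : X → X) (q : X → ι) (α : X → κ) (k : ℕ) : ℝ :=
  condPartEntropy μ (tl T q 1 ⊔ tl T α (k + 1)) q

noncomputable def bb (μ : Measure X) (T : X → X) (q : X → ι) (α : X → κ) (k : ℕ) : ℝ :=
  condPartEntropy μ (tl T q 1 ⊔ tl T α (k + 1)) (fun x => α (T^[k] x))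

section dyn

lemma tt_le {T : X → X} (hT : MeasurePreserving T μ μ) {q : X → ι} (hq : sg q ≤ m0) {α : X → κ} (hα : sg α ≤ m0)
    (j k : ℕ) : tl T q j ⊔ tl T α k ≤ m0 :=
  sup_le (tl_le hT.measurable hq _) (tl_le hT.measurable hα _)

lemma ab_one {T : X → X} (hT : MeasurePreserving T μ μ) {q : X → ι} (hq : sg q ≤ m0) {α : X → κ} (hα : sg α ≤ m0)
    (k : ℕ) : condPartEntropy μ (tl T q 1 ⊔ tl T α (k + 1)) (fun x => (q x, α (T^[k] x))) =
    aa μ T q α k + bb μ T q α (k + 1) := by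
  rw [H_chain (tt_le hT hq hα _ _) hq (sg_comp_le hα (hT.measurable.iterate k))]
  congr 1
  have h1 : tl T q 1 ⊔ tl T α (k + 1) ⊔ sg q = tl T q 0 ⊔ tl T α (k + 1) := by
    rw [sup_right_comm, ← tl_succ_sup T q 0]; rfl
  rw [h1, ← H_shift (tt_le hT hq hα _ _) hT (sg_comp_le hα (hT.measurable.iterate k)),
    MeasurableSpace.comap_sup, tl_comap, tl_comap]
  rfl

lemma ab_two {T : X → X} (hT : MeasurePreserving T μ μ) {q : X → ι} (hq : sg q ≤ m0) {α : X → κ} (hα : sg α ≤ m0)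
    (k : ℕ) : condPartEntropy μ (tl T q 1 ⊔ tl T α (k + 1)) (fun x => (q x, α (T^[k] x))) =
    bb μ T q α k + condPartEntropy μ (tl T q 1 ⊔ tl T α k) q := by
  rw [H_swap, H_chain (tt_le hT hq hα _ _) (sg_comp_le hα (hT.measurable.iterate k)) hq,
    sup_assoc, tl_succ_sup]
  rfl

lemma ab_eq {T : X → X} (hT : MeasurePreserving T μ μ) {q : X → ι} (hq : sg q ≤ m0) {α : X → κ} (hα : sg α ≤ m0)
    (k : ℕ) : partKS μ T (fun x => (q x, α x)) = aa μ T q α k + bb μ T q α (k + 1) := by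
  induction k with
  | zero =>
    rw [← ab_one hT hq hα 0, partKS_eq, tl_prod]
    rfl
  | succ k ih =>
    rw [← ab_one hT hq hα (k + 1), ab_two hT hq hα (k + 1), ih, add_comm]
    rfl

lemma aa_le {T : X → X} (hT : MeasurePreserving T μ μ) {q : X → ι} (hq : sg q ≤ m0) {α : X → κ} (hα : sg α ≤ m0)
    (k : ℕ) : aa μ T q α k ≤ partKS μ T q :=
  H_anti (tl_le hT.measurable hq 1) (tt_le hT hq hα _ _) le_sup_left hq

lemma bb_nonneg {T : X → X} (hT : MeasurePreserving T μ μ) {q : X → ι} (hq : sg q ≤ m0) {α : X → κ} (hα : sg α ≤ m0)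
    (k : ℕ) : 0 ≤ bb μ T q α k :=
  H_nonneg (tt_le hT hq hα _ _) (sg_comp_le hα (hT.measurable.iterate k))

end dyn

/-- finite windows -/
def win {X ι : Type*} (S : X → X) (p : X → ι) (n : ℕ) : MeasurableSpace X :=
  ⨆ s, ⨆ (_ : s < n), sg (fun x => p (S^[s] x))

lemma win_le {S : X → X} (hS : Measurable S) {p : X → ι} (hp : sg p ≤ m0) (n : ℕ) :
    win S p n ≤ m0 := iSup₂_le fun s _ => sg_comp_le hp (hS.iterate s)

lemma win_succ (S : X → X) (p : X → ι) (n : ℕ) :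
    win S p (n + 1) = win S p n ⊔ sg (fun x => p (S^[n] x)) := by
  unfold win
  exact Nat.iSup_lt_succ _ _

lemma win_prod (S : X → X) (p : X → ι) (q : X → κ) (n : ℕ) :
    win S (fun x => (p x, q x)) n = win S p n ⊔ win S q n := by
  unfold win
  rw [← iSup_sup_eq]
  refine iSup_congr fun s => ?_
  rw [← iSup_sup_eq]
  exact iSup_congr fun _ => sg_prod (fun x => p (S^[s] x)) (fun x => q (S^[s] x))

lemma iter_cancel {S T : X → X} (h : ∀ x, S (T x) = x) {s n : ℕ} (hs : s ≤ n) (x : X) :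
    S^[s] (T^[n] x) = T^[n - s] x := by
  obtain ⟨m, rfl⟩ := Nat.exists_eq_add_of_le hs
  rw [Function.iterate_add_apply, Function.LeftInverse.iterate h s]
  congr 1
  omega

lemma win_comap_le {S T : X → X} (h : ∀ x, S (T x) = x) (p : X → ι) {j n : ℕ} (hj : j ≤ n) :
    (win S p j).comap T^[n] ≤ tl T p (n - j + 1) := by
  unfold win
  simp_rw [MeasurableSpace.comap_iSup]
  refine iSup₂_le fun s hs => ?_
  have : (sg (fun x => p (S^[s] x))).comap T^[n] = sg (fun x => p (T^[n - s] x)) := by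
    refine MeasurableSpace.comap_comp.trans ?_
    congr 1
    ext x
    simp only [Function.comp]
    rw [iter_cancel h (by omega)]
  rw [this]
  exact sg_le_tl T p (by omega)

lemma le_win_comap {S T : X → X} (h : ∀ x, S (T x) = x) (p : X → ι) (n : ℕ) :
    (⨆ s, ⨆ (_ : s < n), sg (fun x => p (T^[s + 1] x))) ≤ (win S p n).comap T^[n] := by
  unfold win
  simp_rw [MeasurableSpace.comap_iSup]
  refine iSup₂_le fun s hs => ?_
  refine le_trans ?_ (le_iSup₂ (n - (s + 1)) (by omega))
  have : (sg (fun x => p (S^[n - (s + 1)] x))).comap T^[n] = sg (fun x => p (T^[s + 1] x)) := by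
    refine MeasurableSpace.comap_comp.trans ?_
    congr 1
    ext x
    simp only [Function.comp]
    rw [iter_cancel h (by omega)]
    congr 2
    omega
  rw [this]

lemma grid_sum (h v : ℕ → ℕ → ℝ) (hsq : ∀ i j, h i j + v (i + 1) j = v i j + h i (j + 1)) (n : ℕ) :
    ∑ i ∈ Finset.range n, (h i i + v (i + 1) i) =
      ∑ i ∈ Finset.range n, h i 0 + ∑ j ∈ Finset.range n, v n j := by
  have key : ∀ i n, ∑ j ∈ Finset.range n, v (i + 1) j =
      ∑ j ∈ Finset.range n, v i j + (h i n - h i 0) := by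
    intro i n
    induction n with
    | zero => simp
    | succ n ih => rw [Finset.sum_range_succ, Finset.sum_range_succ, ih]; linarith [hsq i n]
  induction n with
  | zero => simp
  | succ n ih =>
    rw [Finset.sum_range_succ, ih, Finset.sum_range_succ, Finset.sum_range_succ, key n n]
    ring

section dyn2

lemma exists_aa {T S : X → X} (hT : MeasurePreserving T μ μ) (hS : Measurable S) (hST : ∀ x, S (T x) = x) {q : X → ι} (hq : sg q ≤ m0) {α : X → κ} (hα : sg α ≤ m0)
    {ε : ℝ} (hε : 0 < ε) : ∃ k, partKS μ T q - ε < aa μ T q α k := by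
  by_contra! hcon
  let W : ℕ → ℕ → MeasurableSpace X := fun i j => win S q i ⊔ win S α j
  have hW : ∀ i j, W i j ≤ m0 := fun i j => sup_le (win_le hS hq i) (win_le hS hα j)
  have hqS : ∀ i, sg (fun x => q (S^[i] x)) ≤ m0 := fun i => sg_comp_le hq (hS.iterate i)
  have hαS : ∀ i, sg (fun x => α (S^[i] x)) ≤ m0 := fun i => sg_comp_le hα (hS.iterate i)
  have hTn : ∀ n, MeasurePreserving T^[n] μ μ := fun n => hT.iterate n
  let h : ℕ → ℕ → ℝ := fun i j => condPartEntropy μ (W i j) (fun x => q (S^[i] x))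
  let v : ℕ → ℕ → ℝ := fun i j => condPartEntropy μ (W i j) (fun x => α (S^[j] x))
  have hWi : ∀ i j, W (i + 1) j = W i j ⊔ sg (fun x => q (S^[i] x)) := fun i j => by
    simp only [W, win_succ, sup_right_comm]
  have hWj : ∀ i j, W i (j + 1) = W i j ⊔ sg (fun x => α (S^[j] x)) := fun i j => by
    simp only [W, win_succ, sup_assoc]
  have hsq : ∀ i j, h i j + v (i + 1) j = v i j + h i (j + 1) := by
    intro i j
    simp only [h, v, hWi, hWj]
    exact H_chain_comm (hW i j) (hqS i) (hαS j)
  -- the joint partition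
  let R : X → ι × κ := fun x => (q x, α x)
  have hR : sg R ≤ m0 := by rw [sg_prod]; exact sup_le hq hα
  let V : ℕ → MeasurableSpace X := fun n => ⨆ s, ⨆ (_ : s < n), sg (fun x => R (T^[s + 1] x))
  have hV : ∀ n, V n ≤ m0 := fun n =>
    iSup₂_le fun s _ => sg_comp_le hR (hT.measurable.iterate _)
  have hVm : Monotone V := fun a b hab =>
    biSup_mono fun s hs => lt_of_lt_of_le hs hab
  have hVs : ⨆ n, V n = tl T R 1 := by
    refine le_antisymm (iSup_le fun n => iSup₂_le fun s _ => sg_le_tl T R (by omega))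
      (iSup_le fun s => ?_)
    have h1 : sg (fun x => R (T^[s + 1] x)) ≤ V (s + 1) :=
      le_iSup₂ (f := fun t (_ : t < s + 1) => sg (fun x => R (T^[t + 1] x))) s (Nat.lt_succ_self s)
    exact h1.trans (le_iSup V (s + 1))
  have hlim : Tendsto (fun n => condPartEntropy μ (V n) R) atTop (𝓝 (partKS μ T R)) := by
    rw [partKS_eq, ← hVs]
    exact H_tendsto hV hVm hR
  have hr : ∀ i, h i i + v (i + 1) i ≤ condPartEntropy μ (V i) R := by
    intro i
    have e1 : h i i + v (i + 1) i = condPartEntropy μ (W i i) (fun x => R (S^[i] x)) := by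
      simp only [h, v, hWi]
      exact (H_chain (hW i i) (hqS i) (hαS i)).symm
    have e2 := H_shift (μ := μ) (hW i i) (hTn i) (sg_comp_le hR (hS.iterate i))
    have e3 : (fun x => R (S^[i] (T^[i] x))) = R := by
      ext x : 1
      rw [iter_cancel hST le_rfl, Nat.sub_self]; rfl
    rw [e3] at e2
    rw [e1, ← e2]
    have hW' : W i i = win S R i := (win_prod S q α i).symm
    rw [hW']
    have hle := win_le (m0 := m0) hS hR i
    exact H_anti (hV i) ((MeasurableSpace.comap_mono hle).trans (hTn i).measurable.comap_le)
      (le_win_comap hST R i) hR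
  have hh : ∀ i, partKS μ T q ≤ h i 0 := by
    intro i
    have e2 := H_shift (μ := μ) (hW i 0) (hTn i) (hqS i)
    have e3 : (fun x => q (S^[i] (T^[i] x))) = q := by
      ext x : 1
      rw [iter_cancel hST le_rfl, Nat.sub_self]; rfl
    rw [e3] at e2
    change _ ≤ condPartEntropy μ (W i 0) (fun x => q (S^[i] x))
    rw [← e2]
    have h0 : W i 0 = win S q i := by simp [W, win]
    rw [h0]
    refine H_anti ((MeasurableSpace.comap_mono (win_le hS hq i)).trans (hTn i).measurable.comap_le)
      (tl_le hT.measurable hq 1) ?_ hq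
    simpa using win_comap_le hST q (le_refl i)
  have hv : ∀ n j, j < n → bb μ T q α (n - j) ≤ v n j := by
    intro n j hj
    have e2 := H_shift (μ := μ) (hW n j) (hTn n) (hαS j)
    have e3 : (fun x => α (S^[j] (T^[n] x))) = (fun x => α (T^[n - j] x)) := by
      ext x : 1
      rw [iter_cancel hST hj.le]
    rw [e3] at e2
    change _ ≤ condPartEntropy μ (W n j) (fun x => α (S^[j] x))
    rw [← e2]
    refine H_anti ((MeasurableSpace.comap_mono (hW n j)).trans (hTn n).measurable.comap_le)
      (tt_le hT hq hα _ _) ?_ (sg_comp_le hα (hT.measurable.iterate _))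
    simp only [W, MeasurableSpace.comap_sup]
    refine sup_le_sup ?_ (win_comap_le hST α hj.le)
    simpa using win_comap_le hST q (le_refl n)
  have hb : ∀ k, 0 < k → partKS μ T R - (partKS μ T q - ε) ≤ bb μ T q α k := by
    intro k hk
    obtain ⟨k, rfl⟩ := Nat.exists_eq_succ_of_ne_zero hk.ne'
    have := ab_eq hT hq hα k
    have := hcon k
    simp only [R, Nat.succ_eq_add_one]
    linarith
  have hsum : ∀ n : ℕ, (n : ℝ) * (partKS μ T R + ε) ≤
      ∑ i ∈ Finset.range n, condPartEntropy μ (V i) R := by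
    intro n
    have h1 := grid_sum h v hsq n
    have h2 : ∑ i ∈ Finset.range n, (h i i + v (i + 1) i) ≤
      ∑ i ∈ Finset.range n, condPartEntropy μ (V i) R := Finset.sum_le_sum fun i _ => hr i
    have h3 : ∑ i ∈ Finset.range n, partKS μ T q ≤ ∑ i ∈ Finset.range n, h i 0 :=
      Finset.sum_le_sum fun i _ => hh i
    have h4 : ∑ j ∈ Finset.range n, (partKS μ T R - (partKS μ T q - ε)) ≤
        ∑ j ∈ Finset.range n, v n j := Finset.sum_le_sum fun j hj => by
      have hj' := Finset.mem_range.1 hj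
      exact (hb (n - j) (by omega)).trans (hv n j hj')
    rw [Finset.sum_const, Finset.card_range, nsmul_eq_mul] at h3 h4
    linarith
  have hces := hlim.cesaro
  have : partKS μ T R + ε ≤ partKS μ T R := by
    refine ge_of_tendsto hces ?_
    filter_upwards [eventually_gt_atTop 0] with n hn
    have hn' : (0 : ℝ) < n := by exact_mod_cast hn
    rw [inv_mul_eq_div, le_div_iff₀ hn', mul_comm]
    exact hsum n
  linarith

lemma partKS_le_prod {T S : X → X} (hT : MeasurePreserving T μ μ) (hS : Measurable S) (hST : ∀ x, S (T x) = x) {q : X → ι} (hq : sg q ≤ m0) {α : X → κ} (hα : sg α ≤ m0)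
    : partKS μ T q ≤ partKS μ T (fun x => (q x, α x)) := by
  refine le_of_forall_pos_sub_le fun ε hε => ?_
  obtain ⟨k, hk⟩ := exists_aa hT hS hST hq hα hε
  have := ab_eq hT hq hα k
  have := bb_nonneg hT hq hα (k + 1)
  linarith

lemma partKS_mono {T S : X → X} (hT : MeasurePreserving T μ μ) (hS : Measurable S) (hST : ∀ x, S (T x) = x) {q : X → ι} (hq : sg q ≤ m0) {α : X → κ} (hα : sg α ≤ m0)
    (h : sg q ≤ sg α) : partKS μ T q ≤ partKS μ T α := by
  refine (partKS_le_prod hT hS hST hq hα).trans_eq ?_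
  rw [partKS_eq, partKS_eq, H_absorb (tl_le hT.measurable (by
    rw [sg_prod]; exact sup_le hq hα) 1) hq hα h, tl_prod]
  congr 1
  refine sup_eq_right.2 (iSup_le fun n => ?_)
  refine le_trans ?_ (le_iSup (fun n => sg (fun x => α (T^[n + 1] x))) n)
  have e1 : sg (fun x => q (T^[n + 1] x)) = (sg q).comap T^[n + 1] :=
    MeasurableSpace.comap_comp.symm
  have e2 : sg (fun x => α (T^[n + 1] x)) = (sg α).comap T^[n + 1] :=
    MeasurableSpace.comap_comp.symm
  rw [e1, e2]
  exact MeasurableSpace.comap_mono h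

/-- `h(α) ≤ h(q) + H(α_k | q_1, q_2, ...)` -/
lemma partKS_le_add {T S : X → X} (hT : MeasurePreserving T μ μ) (hS : Measurable S) (hST : ∀ x, S (T x) = x) {q : X → ι} (hq : sg q ≤ m0) {α : X → κ} (hα : sg α ≤ m0)
    (k : ℕ) : partKS μ T α ≤ partKS μ T q +
    condPartEntropy μ (tl T q 1) (fun x => α (T^[k + 1] x)) := by
  have h1 : partKS μ T α ≤ partKS μ T (fun x => (q x, α x)) := by
    refine (partKS_le_prod hT hS hST hα hq).trans_eq ?_
    rw [partKS_eq, partKS_eq, H_swap, tl_prod, tl_prod, sup_comm]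
  have h2 := ab_eq hT hq hα k
  have h3 := aa_le hT hq hα k
  have h4 : bb μ T q α (k + 1) ≤ condPartEntropy μ (tl T q 1) (fun x => α (T^[k + 1] x)) :=
    H_anti (tl_le hT.measurable hq 1) (tt_le hT hq hα _ _) le_sup_left
      (sg_comp_le hα (hT.measurable.iterate _))
  linarith

end dyn2

lemma tl_eq (T : X → X) (p : X → ι) (k : ℕ) : tl T p k = ⨆ n : ℕ, (sg p).comap T^[n + k] :=
  iSup_congr fun _ => MeasurableSpace.comap_comp.symm

lemma tl_mono_part (T : X → X) {p : X → ι} {q : X → κ} (h : sg p ≤ sg q) (k : ℕ) :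
    tl T p k ≤ tl T q k := by
  rw [tl_eq, tl_eq]
  exact iSup_mono fun n => MeasurableSpace.comap_mono h

lemma sg_equiv (e : ι ≃ κ) (p : X → ι) : sg (fun x => e (p x)) = sg p := by
  have h : MeasurableSpace.comap e (⊤ : MeasurableSpace κ) = ⊤ := by
    refine eq_top_iff.2 fun s _ => ⟨e '' s, trivial, ?_⟩
    exact e.injective.preimage_image s
  have h2 : sg (fun x => e (p x)) = (MeasurableSpace.comap e ⊤).comap p :=
    MeasurableSpace.comap_comp.symm
  rw [h2, h]

lemma tl_shift (T : X → X) (α : X → κ) (k : ℕ) :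
    tl T (fun x => α (T^[k] x)) 1 = tl T α (k + 1) := by
  refine iSup_congr fun n => ?_
  congr 1
  ext x
  change α (T^[k] (T^[n + 1] x)) = α (T^[n + (k + 1)] x)
  rw [← Function.iterate_add_apply]
  congr 2
  omega

lemma sg_le_of_measurable {k : ℕ} {p : X → Fin k} (hp : Measurable p) : sg p ≤ m0 :=
  hp.comap_le

lemma step {T S : X → X} (hT : MeasurePreserving T μ μ) (hS : Measurable S)
    (hST : ∀ x, S (T x) = x) {m a : ℕ} {q : X → Fin m} (hq : Measurable q) {α : X → Fin a}
    (hα : Measurable α) {ε : ℝ} (hε : 0 < ε) :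
    ∃ (m' : ℕ) (q' : X → Fin m'), Measurable q' ∧ sg q ≤ sg q' ∧
      (∃ k, sg (fun x => α (T^[k] x)) ≤ sg q') ∧
      condPartEntropy μ (tl T q 1) q - condPartEntropy μ (tl T q' 1) q < ε := by
  obtain ⟨k, hk⟩ := exists_aa hT hS hST (sg_le_of_measurable hq) (sg_le_of_measurable hα) hε
  let q' : X → Fin (m * a) := fun x => finProdFinEquiv (q x, α (T^[k] x))
  have hsg : sg q' = sg q ⊔ sg (fun x => α (T^[k] x)) := by
    rw [← sg_prod]
    exact sg_equiv finProdFinEquiv (fun x => (q x, α (T^[k] x)))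
  have htl : tl T q' 1 = tl T q 1 ⊔ tl T α (k + 1) := by
    rw [← tl_shift T α k, ← tl_prod, tl_eq, tl_eq, hsg, sg_prod]
  refine ⟨m * a, q', ?_, ?_, ⟨k, ?_⟩, ?_⟩
  · exact (measurable_of_countable finProdFinEquiv).comp
      (hq.prodMk (hα.comp (hT.measurable.iterate k)))
  · rw [hsg]; exact le_sup_left
  · rw [hsg]; exact le_sup_right
  · rw [htl]
    have : partKS μ T q - aa μ T q α k < ε := by linarith
    exact this

lemma exists_small {Y : Type*} [MetricSpace Y] [CompactSpace Y] [MeasurableSpace Y] [BorelSpace Y]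
    {ε : ℝ} (hε : 0 < ε) : ∃ (k : ℕ) (α : Y → Fin k), Measurable α ∧
      ∀ x y, α x = α y → dist x y < ε := by
  obtain ⟨t, -, hfin, ht⟩ := finite_cover_balls_of_compact
    (isCompact_univ : IsCompact (univ : Set Y)) (half_pos hε)
  have : Fintype t := hfin.fintype
  let β : Y → (t → Bool) := fun x c => decide (x ∈ Metric.ball (c : Y) (ε / 2))
  have hβ : Measurable β := measurable_pi_iff.2 fun c =>
    measurable_to_bool (by
      have : (fun x : Y => decide (x ∈ Metric.ball (c : Y) (ε / 2))) ⁻¹' {true}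
          = Metric.ball (c : Y) (ε / 2) := by
        ext x; simp
      change MeasurableSet ((fun x : Y => decide (x ∈ Metric.ball (c : Y) (ε / 2))) ⁻¹' {true})
      rw [this]
      exact Metric.isOpen_ball.measurableSet)
  refine ⟨_, fun x => Fintype.equivFin (t → Bool) (β x),
    (measurable_of_countable _).comp hβ, fun x y hxy => ?_⟩
  have hxy' : β x = β y := (Fintype.equivFin (t → Bool)).injective hxy
  obtain ⟨c, hc, hxc⟩ := mem_iUnion₂.1 (ht (mem_univ x))
  have h1 := congrFun hxy' ⟨c, hc⟩
  simp only [β, decide_eq_decide] at h1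
  have h2 := h1.1 hxc
  have := dist_triangle_right x y c
  rw [Metric.mem_ball] at hxc h2
  linarith

lemma pastAlg_eq {m : ℕ → ℕ} (T : X → X) (Q : ∀ n, X → Fin (m n)) :
    pastAlg T (⨆ n, sg (Q n)) = ⨆ n, tl T (Q n) 1 := by
  unfold pastAlg
  simp_rw [MeasurableSpace.comap_iSup, tl_eq]
  exact iSup_comm

lemma part_one {Y : Type*} [MetricSpace Y] [CompactSpace Y] [m0 : MeasurableSpace Y] [BorelSpace Y]
    (T : Y ≃ₜ Y) (μ : Measure Y) [IsProbabilityMeasure μ] (hT : MeasurePreserving T μ μ) :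
    ∃ P : MeasurableSpace Y, @IsExcellentPartition Y P m0 μ (⇑T) (⇑T.symm) ∧
      ∀ x y : Y, (∀ A : Set Y, MeasurableSet[pastAlg (⇑T) P] A → (x ∈ A ↔ y ∈ A)) →
        IsAsymptoticPair (⇑T) x y := by
  have hS : Measurable T.symm := T.symm.continuous.measurable
  have hST : ∀ x, T.symm (T x) = x := T.symm_apply_apply
  have hTS : ∀ x, T (T.symm x) = x := T.apply_symm_apply
  have hex : ∀ n : ℕ, ∃ (k : ℕ) (α : Y → Fin k), Measurable α ∧
      ∀ x y, α x = α y → dist x y < 1 / ((n : ℝ) + 1) := fun n => exists_small (by positivity)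
  choose a α hαm hαd using hex
  let St := {s : Σ m : ℕ, (Y → Fin m) // Measurable s.2}
  have hstep : ∀ (n : ℕ) (s : St), ∃ s' : St, sg s.1.2 ≤ sg s'.1.2 ∧
      (∃ k, sg (fun x => α (n + 1) (T^[k] x)) ≤ sg s'.1.2) ∧
      condPartEntropy μ (tl T s.1.2 1) s.1.2 - condPartEntropy μ (tl T s'.1.2 1) s.1.2
        < (1 / 2) ^ n := by
    rintro n ⟨⟨m, q⟩, hq⟩
    obtain ⟨m', q', hq', h⟩ := step hT hS hST hq (hαm (n + 1)) (ε := (1 / 2) ^ n) (by positivity)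
    exact ⟨⟨⟨m', q'⟩, hq'⟩, h⟩
  choose nxt hn1 hn2 hn3 using hstep
  let st : ℕ → St := fun n => Nat.rec ⟨⟨a 0, α 0⟩, hαm 0⟩ (fun n s => nxt n s) n
  let m : ℕ → ℕ := fun n => (st n).1.1
  let Q : ∀ n, Y → Fin (m n) := fun n => (st n).1.2
  have hQm : ∀ n, Measurable (Q n) := fun n => (st n).2
  have hQs : ∀ n, sg (Q n) ≤ m0 := fun n => sg_le_of_measurable (hQm n)
  have hmono : Monotone (fun n => sg (Q n)) := monotone_nat_of_le_succ fun n => hn1 n (st n)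
  have hα : ∀ n, ∃ k, sg (fun x => α n (T^[k] x)) ≤ sg (Q n) := by
    intro n
    cases n with
    | zero => exact ⟨0, le_rfl⟩
    | succ n => exact hn2 n (st n)
  have hgap : ∀ n, condPartEntropy μ (tl T (Q n) 1) (Q n) -
      condPartEntropy μ (tl T (Q (n + 1)) 1) (Q n) < (1 / 2) ^ n := fun n => hn3 n (st n)
  have htle : ∀ n, tl T (Q n) 1 ≤ m0 := fun n => tl_le hT.measurable (hQs n) 1
  have htm : Monotone (fun n => tl T (Q n) 1) := fun i j hij => tl_mono_part T (hmono hij) 1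
  have hpast : pastAlg T (⨆ n, sg (Q n)) = ⨆ n, tl T (Q n) 1 := pastAlg_eq T Q
  have hpl : (⨆ n, tl T (Q n) 1) ≤ m0 := iSup_le htle
  refine ⟨⨆ n, sg (Q n), ⟨iSup_le hQs, ?_, m, Q, hQm, hmono, rfl, ?_⟩, ?_⟩
  · -- generating
    have hle : m0 ≤ hullAlg T T.symm (⨆ n, sg (Q n)) := by
      have hαh : ∀ n, sg (α n) ≤ hullAlg T T.symm (⨆ n, sg (Q n)) := by
        intro n
        obtain ⟨k, hk⟩ := hα n
        have h1 : sg (α n) = (sg (fun x => α n (T^[k] x))).comap T.symm^[k] := by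
          refine Eq.trans ?_ MeasurableSpace.comap_comp.symm
          congr 1
          ext x : 1
          exact congrArg (α n) (Function.LeftInverse.iterate hTS k x).symm
        rw [h1]
        refine le_trans (MeasurableSpace.comap_mono (hk.trans (le_iSup (fun n => sg (Q n)) n))) ?_
        exact le_trans le_sup_right (le_iSup (fun n : ℕ => MeasurableSpace.comap (T^[n])
          (⨆ n, sg (Q n)) ⊔ MeasurableSpace.comap (T.symm^[n]) (⨆ n, sg (Q n))) k)
      rw [BorelSpace.measurable_eq (α := Y)]
      refine MeasurableSpace.generateFrom_le fun U hU => ?_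
      have hUe : U = ⋃ n : ℕ, ⋃ i : Fin (a n), ⋃ (_ : α n ⁻¹' {i} ⊆ U), α n ⁻¹' {i} := by
        refine subset_antisymm (fun x hx => ?_) (iUnion_subset fun n => iUnion_subset fun i =>
          iUnion_subset fun h => h)
        obtain ⟨ε, hε, hb⟩ := Metric.isOpen_iff.1 hU x hx
        obtain ⟨n, hn⟩ := exists_nat_one_div_lt hε
        refine mem_iUnion.2 ⟨n, mem_iUnion.2 ⟨α n x, mem_iUnion.2 ⟨fun y hy => hb ?_, rfl⟩⟩⟩
        exact (hαd n y x hy).trans hn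
      rw [hUe]
      exact MeasurableSet.iUnion fun n => MeasurableSet.iUnion fun i => MeasurableSet.iUnion fun _ =>
        hαh n _ (sg_fiber (α n) i)
    exact fun A hA => ⟨A, hle A hA, by simp⟩
  · -- excellence
    rw [hpast]
    have hlow : ∀ n d, condPartEntropy μ (tl T (Q n) 1) (Q n) -
        condPartEntropy μ (tl T (Q (n + d)) 1) (Q n) ≤ 2 * (1 / 2) ^ n - 2 * (1 / 2) ^ (n + d) := by
      intro n d
      induction d with
      | zero => simp
      | succ d ih =>
        have h1 := H_diff (μ := μ) (htle (n + d)) (htle (n + d + 1)) (htm (Nat.le_succ _)) (hQs n)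
          (hQs (n + d)) (hmono (Nat.le_add_right n d))
        have h2 := hgap (n + d)
        have h3 : (1 / 2 : ℝ) ^ (n + (d + 1)) = (1 / 2) ^ (n + d) / 2 := by
          rw [← add_assoc, pow_succ]; ring
        rw [h3]
        change _ - condPartEntropy μ (tl T (Q (n + d + 1)) 1) (Q n) ≤ _
        linarith
    have hub : ∀ n, condPartEntropy μ (tl T (Q n) 1) (Q n) -
        condPartEntropy μ (⨆ n, tl T (Q n) 1) (Q n) ≤ 2 * (1 / 2) ^ n := by
      intro n
      have hl := H_tendsto (μ := μ) htle htm (hQs n)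
      have hl2 := (tendsto_const_nhds (x := condPartEntropy μ (tl T (Q n) 1) (Q n))).sub hl
      refine le_of_tendsto hl2 ?_
      filter_upwards [eventually_ge_atTop n] with j hj
      obtain ⟨d, rfl⟩ := Nat.exists_eq_add_of_le hj
      have h4 : (0 : ℝ) ≤ 2 * (1 / 2) ^ (n + d) := by positivity
      linarith [hlow n d]
    have hz : Tendsto (fun n : ℕ => 2 * (1 / 2 : ℝ) ^ n) atTop (𝓝 0) := by
      simpa using (tendsto_pow_atTop_nhds_zero_of_lt_one (r := (1 / 2 : ℝ)) (by norm_num)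
        (by norm_num)).const_mul 2
    refine squeeze_zero (fun n => sub_nonneg.2 ?_) hub hz
    exact H_anti (htle n) hpl (le_iSup (fun n => tl T (Q n) 1) n) (hQs n)
  · -- asymptotic
    intro x y hxy
    rw [hpast] at hxy
    refine Metric.tendsto_atTop.2 fun ε hε => ?_
    obtain ⟨n, hn⟩ := exists_nat_one_div_lt hε
    obtain ⟨k, hk⟩ := hα n
    refine ⟨k + 1, fun j hj => ?_⟩
    have hle : sg (fun z => α n (T^[j] z)) ≤ ⨆ n, tl T (Q n) 1 := by
      refine le_trans ?_ (le_iSup (fun n => tl T (Q n) 1) n)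
      refine le_trans ?_ (tl_mono_part T hk 1)
      rw [tl_shift]
      exact sg_le_tl T (α n) hj
    have h1 := (hxy _ (hle _ (sg_fiber (fun z => α n (T^[j] z)) (α n (T^[j] x))))).1 rfl
    have h2 : α n (T^[j] y) = α n (T^[j] x) := h1
    rw [Real.dist_0_eq_abs, abs_of_nonneg dist_nonneg]
    exact (hαd n _ _ h2.symm).trans hn

lemma part_two {Y : Type*} [MetricSpace Y] [CompactSpace Y] [m0 : MeasurableSpace Y] [BorelSpace Y]
    (T : Y ≃ₜ Y) (μ : Measure Y) [IsProbabilityMeasure μ] (hT : MeasurePreserving T μ μ)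
    {m : ℕ → ℕ} (Q : ∀ n : ℕ, Y → Fin (m n)) (hQm : ∀ n, Measurable (Q n))
    (hmono : Monotone (fun n => sg (Q n)))
    (hgen : SubModNull μ m0 (hullAlg T T.symm (⨆ n, sg (Q n))))
    (hlim : Tendsto (fun n => condPartEntropy μ (partPast T (Q n)) (Q n) -
      condPartEntropy μ (pastAlg T (⨆ n, sg (Q n))) (Q n)) atTop (𝓝 0))
    (hsub : SubModNull μ m0 (pastAlg T (⨆ n, sg (Q n)))) : ksEntropy μ T = 0 := by
  have hS : Measurable T.symm := T.symm.continuous.measurable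
  have hST : ∀ x, T.symm (T x) = x := T.symm_apply_apply
  have hTS : ∀ x, T (T.symm x) = x := T.apply_symm_apply
  have hQs : ∀ n, sg (Q n) ≤ m0 := fun n => sg_le_of_measurable (hQm n)
  have htle : ∀ n, tl T (Q n) 1 ≤ m0 := fun n => tl_le hT.measurable (hQs n) 1
  have hpl : pastAlg T (⨆ n, sg (Q n)) ≤ m0 := by
    rw [pastAlg_eq]; exact iSup_le htle
  have hH0 : ∀ n, condPartEntropy μ (pastAlg T (⨆ n, sg (Q n))) (Q n) = 0 := fun n =>
    H_zero hpl fun i => hsub _ (hQs n _ (sg_fiber (Q n) i))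
  simp_rw [hH0, sub_zero] at hlim
  have hKm : Monotone (fun n => partKS μ T (Q n)) := fun i j hij =>
    partKS_mono hT hS hST (hQs i) (hQs j) (hmono hij)
  have hK : ∀ n, partKS μ T (Q n) ≤ 0 := fun n => hKm.ge_of_tendsto hlim n
  let G : ℕ → MeasurableSpace Y := fun n => (tl T (Q n) 1).comap T.symm^[n + 1]
  have hG : ∀ n, G n ≤ m0 := fun n =>
    (MeasurableSpace.comap_mono (htle n)).trans (hS.iterate _).comap_le
  have hin : ∀ n j, j ≤ n → sg (fun x => Q n (T.symm^[j] x)) ≤ G n := by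
    intro n j hj
    have h1 := MeasurableSpace.comap_mono (g := T.symm^[n + 1])
      (sg_le_tl T (Q n) (k := 1) (n := n + 1 - j) (by omega))
    refine le_trans (le_of_eq ?_) h1
    refine Eq.trans ?_ MeasurableSpace.comap_comp.symm
    congr 1
    ext x : 1
    simp only [Function.comp]
    rw [iter_cancel hTS (by omega)]
    congr 2
    omega
  have hin2 : ∀ n j, sg (fun x => Q n (T^[j] x)) ≤ G n := by
    intro n j
    have h1 := MeasurableSpace.comap_mono (g := T.symm^[n + 1])
      (sg_le_tl T (Q n) (k := 1) (n := j + (n + 1)) (by omega))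
    refine le_trans (le_of_eq ?_) h1
    refine Eq.trans ?_ MeasurableSpace.comap_comp.symm
    congr 1
    ext x : 1
    simp only [Function.comp]
    rw [Function.iterate_add_apply, Function.LeftInverse.iterate hTS]
  have hGm : Monotone G := by
    refine monotone_nat_of_le_succ fun n => ?_
    have h1 : tl T (Q n) 1 ≤ tl T (Q (n + 1)) 1 := tl_mono_part T (hmono (Nat.le_succ n)) 1
    refine (MeasurableSpace.comap_mono h1).trans ?_
    have h2 : tl T (Q (n + 1)) 1 = (tl T (Q (n + 1)) 2).comap T.symm := by
      rw [← tl_comap T (Q (n + 1)) 1, MeasurableSpace.comap_comp]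
      have : (T ∘ T.symm : Y → Y) = id := funext hTS
      rw [this, MeasurableSpace.comap_id]
    have h3 : G (n + 1) = ((tl T (Q (n + 1)) 1).comap T.symm).comap T.symm^[n + 1] := by
      rw [MeasurableSpace.comap_comp, ← Function.iterate_succ']
    rw [h2, h3]
    exact MeasurableSpace.comap_mono (MeasurableSpace.comap_mono (tl_anti T _ (by omega)))
  have hGs : ⨆ n, G n ≤ m0 := iSup_le hG
  have hhull : hullAlg T T.symm (⨆ n, sg (Q n)) ≤ ⨆ n, G n := by
    refine iSup_le fun j => sup_le ?_ ?_
    · rw [MeasurableSpace.comap_iSup]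
      refine iSup_le fun n => ?_
      rw [show (sg (Q n)).comap T^[j] = sg (fun x => Q n (T^[j] x)) from MeasurableSpace.comap_comp]
      exact (hin2 n j).trans (le_iSup G n)
    · rw [MeasurableSpace.comap_iSup]
      refine iSup_le fun n => ?_
      refine (MeasurableSpace.comap_mono (hmono (le_max_left n j))).trans ?_
      refine le_trans (le_of_eq ?_) ((hin (max n j) j (le_max_right n j)).trans (le_iSup G _))
      exact MeasurableSpace.comap_comp
  have hfin : ∀ (k : ℕ) (p : Y → Fin k), Measurable p → partKS μ T p ≤ 0 := by
    intro k p hp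
    have hps : sg p ≤ m0 := sg_le_of_measurable hp
    have h0 : condPartEntropy μ (⨆ n, G n) p = 0 := H_zero hGs fun i => by
      obtain ⟨B, hB, h⟩ := hgen _ (hps _ (sg_fiber p i))
      exact ⟨B, hhull _ hB, h⟩
    have ht := H_tendsto (μ := μ) hG hGm hps
    rw [h0] at ht
    refine ge_of_tendsto' ht fun n => ?_
    have h1 := partKS_le_add hT hS hST (hQs n) hps n
    have h2 := H_shift (μ := μ) (hG n) (hT.iterate (n + 1)) hps
    have h3 : (G n).comap T^[n + 1] = tl T (Q n) 1 := by
      simp only [G]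
      rw [MeasurableSpace.comap_comp]
      have : (T.symm^[n + 1] ∘ T^[n + 1] : Y → Y) = id :=
        funext (Function.LeftInverse.iterate hST (n + 1))
      rw [this, MeasurableSpace.comap_id]
    rw [h3] at h2
    linarith [hK n]
  unfold ksEntropy
  refine le_antisymm (iSup_le fun k => iSup_le fun p => iSup_le fun hp => ?_) bot_le
  rw [ENNReal.ofReal_of_nonpos (hfin k p hp)]
end AsymAux

end Helpers
/-- Let `μ` be a `T`-ergodic Borel probability measure on a compact
metric space. (i) There is an excellent measurable partition `P` such that any two
points in the same atom of `P⁻` are asymptotic. (ii) If moreover `h_μ(X,T) > 0`, then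
for any such partition the σ-algebras `σ(P⁻)` and `B` do not coincide mod `μ`-null
sets. -/
theorem exists_excellent_partition_asymptotic_atoms
    {X : Type*} [MetricSpace X] [CompactSpace X] [m0 : MeasurableSpace X] [BorelSpace X]
    (T : X ≃ₜ X) (μ : Measure X) [IsProbabilityMeasure μ] (herg : Ergodic (⇑T) μ) :
    (∃ P : MeasurableSpace X, @IsExcellentPartition X P m0 μ (⇑T) (⇑T.symm) ∧
      ∀ x y : X, (∀ A : Set X, MeasurableSet[pastAlg (⇑T) P] A → (x ∈ A ↔ y ∈ A)) →
        IsAsymptoticPair (⇑T) x y) ∧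
    (0 < ksEntropy μ (⇑T) →
      ∀ P : MeasurableSpace X, @IsExcellentPartition X P m0 μ (⇑T) (⇑T.symm) →
        (∀ x y : X, (∀ A : Set X, MeasurableSet[pastAlg (⇑T) P] A → (x ∈ A ↔ y ∈ A)) →
          IsAsymptoticPair (⇑T) x y) →
        ¬ @SubModNull X m0 μ m0 (pastAlg (⇑T) P)) := by
  constructor
  · exact AsymAux.part_one T μ herg.toMeasurePreserving
  · rintro hpos P ⟨hP, hgen, m, Q, hQm, hmono, rfl, hlim⟩ - hsub
    exact hpos.ne' (AsymAux.part_two T μ herg.toMeasurePreserving Q hQm hmono hgen hlim hsub)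
end
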